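/- Let γ be a simple closed curve in X. Then Int γ locally extends geodesics: every X-geodesic [p,q]_X contained in Int γ extends to an X-geodesic [p,q']_X contained in Int γ with [p,q]_X properly contained in [p,q']_X. -/

import Mathlib

open Set Metric Filter

noncomputable section

namespace Cat2Cx

/-! ### Comparison angles -/

/-- Inverse hyperbolic cosine. -/
def arcosh (x : ℝ) : ℝ := Real.log (x + Real.sqrt (x ^ 2 - 1))

/-- The Euclidean comparison angle at the vertex of a (comparison) triangle whose adjacent
sides have lengths `a`, `b` and whose opposite side has length `c`, via the law of cosines. -/
def euclCompAngle (a b c : ℝ) : ℝ :=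
  Real.arccos ((a ^ 2 + b ^ 2 - c ^ 2) / (2 * a * b))

/-- The comparison angle in the model plane `M_κ²` of constant curvature `κ ≤ 0`, via the
(Euclidean or hyperbolic) law of cosines. -/
def compAngle (κ a b c : ℝ) : ℝ :=
  if κ = 0 then euclCompAngle a b c
  else
    Real.arccos
      ((Real.cosh (Real.sqrt (-κ) * a) * Real.cosh (Real.sqrt (-κ) * b) -
          Real.cosh (Real.sqrt (-κ) * c)) /
        (Real.sinh (Real.sqrt (-κ) * a) * Real.sinh (Real.sqrt (-κ) * b)))

variable {Z : Type*}

/-! ### Geodesics with respect to a distance function -/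

/-- `f` restricted to `[a,b]` is a unit-speed geodesic for the distance function `d`
(an isometric embedding of the compact interval `[a,b]`). -/
def IsGeodesicWrt (d : Z → Z → ℝ) (f : ℝ → Z) (a b : ℝ) : Prop :=
  a ≤ b ∧ ∀ s ∈ Icc a b, ∀ t ∈ Icc a b, d (f s) (f t) = |s - t|

/-- `f` is a unit-speed geodesic from `x` to `y` (for the distance function `d`),
staying inside `S`. -/
def IsGeodesicFromTo (d : Z → Z → ℝ) (S : Set Z) (f : ℝ → Z) (x y : Z) : Prop :=
  f 0 = x ∧ f (d x y) = y ∧ IsGeodesicWrt d f 0 (d x y) ∧ MapsTo f (Icc 0 (d x y)) S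

/-- `S`, with the distance function `d`, is a geodesic space. -/
def GeodesicSpaceWrt (d : Z → Z → ℝ) (S : Set Z) : Prop :=
  ∀ x ∈ S, ∀ y ∈ S, ∃ f, IsGeodesicFromTo d S f x y

/-- The geodesic segment `[x,y]`: the union of (the images of) all geodesics from `x` to `y`
inside `S`.  In a uniquely geodesic space this is the image of the unique geodesic. -/
def geodSeg (d : Z → Z → ℝ) (S : Set Z) (x y : Z) : Set Z :=
  ⋃ f ∈ {f : ℝ → Z | IsGeodesicFromTo d S f x y}, f '' Icc 0 (d x y)

/-- `C ⊆ S` is geodesically convex with respect to `d`: every geodesic (in `S`) between two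
points of `C` lies in `C`. -/
def ConvexWrtIn (d : Z → Z → ℝ) (S C : Set Z) : Prop :=
  ∀ x ∈ C, ∀ y ∈ C, geodSeg d S x y ⊆ C

/-- `C` is geodesically convex with respect to `d`. -/
abbrev ConvexWrt (d : Z → Z → ℝ) (C : Set Z) : Prop := ConvexWrtIn d univ C

/-- The geodesically convex hull of `A` with respect to `d`. -/
def convexHullWrt (d : Z → Z → ℝ) (A : Set Z) : Set Z :=
  ⋂₀ {C | ConvexWrt d C ∧ A ⊆ C}

/-- The Alexandrov (upper) angle at `p` between two paths `σ`, `τ` issuing from `p`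
(each parametrized so that `σ 0 = τ 0 = p`): the limit as `ε → 0⁺` (i.e. the infimum over
`ε > 0`) of the supremum over `0 < s, t < ε` of the Euclidean comparison angles. -/
def upperAngleWrt (d : Z → Z → ℝ) (p : Z) (σ τ : ℝ → Z) : ℝ :=
  sInf {a | ∃ ε > 0, a = sSup {b | ∃ s t : ℝ, 0 < s ∧ s < ε ∧ 0 < t ∧ t < ε ∧
      b = euclCompAngle (d p (σ s)) (d p (τ t)) (d (σ s) (τ t))}}

/-- The CAT(κ) condition (for `κ ≤ 0`), in the angle-comparison form
(Bridson–Haefliger II.1.7(4)): `S` is geodesic and for every triple of distinct points the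
Alexandrov angle between geodesics is at most the comparison angle in `M_κ²`. -/
def IsCATWrt (κ : ℝ) (d : Z → Z → ℝ) (S : Set Z) : Prop :=
  GeodesicSpaceWrt d S ∧
    ∀ p ∈ S, ∀ q ∈ S, ∀ r ∈ S, p ≠ q → p ≠ r → q ≠ r →
      ∀ σ τ : ℝ → Z, IsGeodesicFromTo d S σ p q → IsGeodesicFromTo d S τ p r →
        upperAngleWrt d p σ τ ≤ compAngle κ (d p q) (d p r) (d q r)

/-- Completeness of `S` with respect to the distance function `d`:
every Cauchy sequence converges. -/
def CompleteWrt (d : Z → Z → ℝ) (S : Set Z) : Prop :=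
  ∀ u : ℕ → Z, (∀ n, u n ∈ S) →
    (∀ ε > 0, ∃ N, ∀ m ≥ N, ∀ n ≥ N, d (u m) (u n) < ε) →
    ∃ x ∈ S, ∀ ε > 0, ∃ N, ∀ n ≥ N, d (u n) x < ε

variable {X : Type*} [MetricSpace X]

/-- `X` is a CAT(κ) metric space. -/
def IsCATSpace (κ : ℝ) (X : Type*) [MetricSpace X] : Prop :=
  IsCATWrt κ (fun x y : X => dist x y) univ

/-- The distance function of the metric space `X`. -/
abbrev xDist (X : Type*) [MetricSpace X] : X → X → ℝ := fun x y => dist x y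

/-! ### The model plane `M_κ²` and polyhedral 2-complexes -/

/-- The distance function of the model plane `M_κ²` of constant curvature `κ ≤ 0`, in global
coordinates `ℝ²`: the Euclidean distance for `κ = 0`, and for `κ < 0` the distance of the
hyperboloid model rescaled by `1/√(-κ)` (so that the curvature is `κ`). -/
def mDist (κ : ℝ) (u v : ℝ × ℝ) : ℝ :=
  if κ = 0 then Real.sqrt ((u.1 - v.1) ^ 2 + (u.2 - v.2) ^ 2)
  else
    (1 / Real.sqrt (-κ)) *
      arcosh (Real.sqrt (1 + u.1 ^ 2 + u.2 ^ 2) * Real.sqrt (1 + v.1 ^ 2 + v.2 ^ 2) -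
        u.1 * v.1 - u.2 * v.2)

/-- A convex polygonal 2-cell in `M_κ²`: the geodesically convex hull of a finite set of
points, with nonempty interior. -/
def IsPolygonalCell (κ : ℝ) (P : Set (ℝ × ℝ)) : Prop :=
  ∃ F : Finset (ℝ × ℝ), P = convexHullWrt (mDist κ) (F : Set (ℝ × ℝ)) ∧ (interior P).Nonempty

/-- The subset `S` of `X` embeds isometrically into the model plane `M_κ²`. -/
def IsomEmbedsInModelPlane (κ : ℝ) (S : Set X) : Prop :=
  ∃ f : X → ℝ × ℝ, ∀ x ∈ S, ∀ y ∈ S, mDist κ (f x) (f y) = dist x y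

/-- A locally finite `M_κ`-polyhedral 2-complex structure on the metric space `X`:
`X` is partitioned into open 2-cells (faces), open 1-cells (edges) and vertices; the closure of
each face is isometric to a compact convex polygon of the model plane `M_κ²` (so each face has
constant curvature `κ`), each edge is a geodesic arc, and the complex is locally finite. -/
structure PolyComplex2 (κ : ℝ) (X : Type*) [MetricSpace X] where
  faces : Set (Set X)
  edges : Set (Set X)
  vertices : Set X
  faces_open : ∀ F ∈ faces, IsOpen F
  cover : ⋃₀ faces ∪ ⋃₀ edges ∪ vertices = univ
  cells_disjoint : ∀ c ∈ faces ∪ edges, ∀ c' ∈ faces ∪ edges, c ≠ c' → c ∩ c' = ∅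
  cells_vertex_disjoint : ∀ c ∈ faces ∪ edges, c ∩ vertices = ∅
  face_chart : ∀ F ∈ faces, ∃ (f : X → ℝ × ℝ) (P : Set (ℝ × ℝ)),
    IsPolygonalCell κ P ∧ InjOn f (closure F) ∧ f '' closure F = P ∧ f '' F = interior P ∧
    ∀ x ∈ closure F, ∀ y ∈ closure F, mDist κ (f x) (f y) = dist x y
  edge_geodesic : ∀ e ∈ edges, ∃ (f : ℝ → X) (L : ℝ), 0 < L ∧
    IsGeodesicWrt (fun x y : X => dist x y) f 0 L ∧ f '' Ioo 0 L = e
  edge_closure : ∀ e ∈ edges, closure e \ e ⊆ vertices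
  face_closure : ∀ F ∈ faces, closure F \ F ⊆ ⋃₀ edges ∪ vertices
  locally_finite : ∀ x : X, ∃ ε > 0,
    {c | (c ∈ faces ∨ c ∈ edges) ∧ (c ∩ ball x ε).Nonempty}.Finite ∧
    (vertices ∩ ball x ε).Finite

/-! ### Simple closed curves, their interiors, and first homology -/

/-- A simple closed curve in `X` (identified with its image). -/
structure SCC (X : Type*) [TopologicalSpace X] where
  toFun : ℝ → X
  contOn : ContinuousOn toFun (Icc 0 1)
  loop : toFun 0 = toFun 1
  inj : InjOn toFun (Ico 0 1)

/-- The image of a simple closed curve. -/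
def SCC.img {X : Type*} [TopologicalSpace X] (γ : SCC X) : Set X := γ.toFun '' Icc 0 1

/-- The first singular homology class of a loop, via the Hurewicz isomorphism: the class of
the loop in the abelianization of the fundamental group (of its path component); the loop is
nullhomologous iff this class is trivial. -/
def loopClassH1 {B : Type*} [TopologicalSpace B] {x : B} (p : Path x x) :
    Abelianization (FundamentalGroup B x) :=
  Abelianization.of (FundamentalGroup.fromPath (X := TopCat.of B) ⟦p⟧)

/-- The basepoint of a simple closed curve, regarded in a subspace `B` containing it. -/
def SCC.basePoint {X : Type*} [TopologicalSpace X] (γ : SCC X) (B : Set X)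
    (h : γ.img ⊆ B) : B :=
  ⟨γ.toFun 0, h ⟨0, ⟨le_rfl, zero_le_one⟩, rfl⟩⟩

/-- The loop of a simple closed curve, as a `Path` in a subspace `B` containing it. -/
def SCC.pathIn {X : Type*} [TopologicalSpace X] (γ : SCC X) (B : Set X) (h : γ.img ⊆ B) :
    Path (γ.basePoint B h) (γ.basePoint B h) where
  toFun t := ⟨γ.toFun t, h ⟨(t : ℝ), t.2, rfl⟩⟩
  continuous_toFun := by
    apply Continuous.subtype_mk
    exact γ.contOn.comp_continuous continuous_subtype_val fun t => t.2
  source' := by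
    apply Subtype.ext
    rfl
  target' := by
    apply Subtype.ext
    exact γ.loop.symm

/-- The simple closed curve `γ` is nullhomologous in the subspace `B` of `X`:
its class in `H₁(B)` vanishes. -/
def SCC.NullhomologousIn {X : Type*} [TopologicalSpace X] (γ : SCC X) (B : Set X) : Prop :=
  ∀ h : γ.img ⊆ B, loopClassH1 (γ.pathIn B h) = 1

/-- The interior of a simple closed curve `γ`:
`Int γ = {x ∈ X \ γ | [γ] ≠ 0 ∈ H₁(X \ {x})}`. -/
def SCC.interiorSet {X : Type*} [TopologicalSpace X] (γ : SCC X) : Set X :=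
  {x | x ∉ γ.img ∧ ¬ γ.NullhomologousIn {x}ᶜ}

/-- The first singular homology of `B` vanishes: every loop in `B` is nullhomologous
(via the Hurewicz isomorphism on each path component). -/
def H1Trivial (B : Type*) [TopologicalSpace B] : Prop :=
  ∀ (x : B) (p : Path x x), loopClassH1 p = 1

/-! ### Rectifiable connectedness and the induced path metric -/

/-- `g` is a path from `x` to `y` (parametrized by `[0,1]`) inside `E`. -/
def IsPathIn {X : Type*} [TopologicalSpace X] (E : Set X) (g : ℝ → X) (x y : X) : Prop :=
  ContinuousOn g (Icc 0 1) ∧ g 0 = x ∧ g 1 = y ∧ MapsTo g (Icc 0 1) E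

/-- `E` is rectifiably connected: any two of its points are joined by a rectifiable
(finite length) path in `E`. -/
def RectConnected {X : Type*} [MetricSpace X] (E : Set X) : Prop :=
  ∀ x ∈ E, ∀ y ∈ E, ∃ g : ℝ → X, IsPathIn E g x y ∧ eVariationOn g (Icc 0 1) ≠ ⊤

/-- The induced path metric on `E`: the infimum of the lengths of rectifiable paths in `E`
joining the two points. -/
def pathDistIn {X : Type*} [MetricSpace X] (E : Set X) (x y : X) : ℝ :=
  (⨅ g : {g : ℝ → X // IsPathIn E g x y}, eVariationOn g.1 (Icc 0 1)).toReal

universe u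
/-! ### Conical neighborhoods -/

/-- The distance function of the `κ`-cone (κ ≤ 0) over a space with distance function `dL`:
a point is a pair (radius, link point), all points of radius `0` being identified (the cone
point); the distance is given by the law of cosines in curvature `κ`, with angle
`min π (dL ℓ ℓ')`. -/
def coneDist (κ : ℝ) {L : Type*} (dL : L → L → ℝ) (a b : ℝ × L) : ℝ :=
  if κ = 0 then
    Real.sqrt (a.1 ^ 2 + b.1 ^ 2 - 2 * a.1 * b.1 * Real.cos (min Real.pi (dL a.2 b.2)))
  else
    (1 / Real.sqrt (-κ)) *
      arcosh (Real.cosh (Real.sqrt (-κ) * a.1) * Real.cosh (Real.sqrt (-κ) * b.1) -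
        Real.sinh (Real.sqrt (-κ) * a.1) * Real.sinh (Real.sqrt (-κ) * b.1) *
          Real.cos (min Real.pi (dL a.2 b.2)))

/-- `V` is a conical neighborhood of `p` in `X`: an open neighborhood of `p` isometric to a
convex open subset of the `κ`-cone over a metric space (the link of `p`), the isometry taking
`p` to the cone point. -/
def IsConicalNbhd (κ : ℝ) (p : X) (V : Set X) : Prop :=
  IsOpen V ∧ p ∈ V ∧
    ∃ (L : Type u) (dL : L → L → ℝ) (f : X → ℝ × L),
      (∀ a, dL a a = 0) ∧ (∀ a b, 0 ≤ dL a b) ∧ (∀ a b, dL a b = dL b a) ∧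
      (∀ a b c, dL a c ≤ dL a b + dL b c) ∧
      (∀ x ∈ V, 0 ≤ (f x).1) ∧ (f p).1 = 0 ∧
      (∀ x ∈ V, ∀ y ∈ V, dist x y = coneDist κ dL (f x) (f y)) ∧
      (∀ x ∈ V, (f x).1 = 0 → x = p) ∧
      ConvexWrtIn (coneDist κ dL) {w : ℝ × L | 0 ≤ w.1} (f '' V) ∧
      (∀ z ∈ f '' V, ∃ ε > 0, ∀ w : ℝ × L, 0 ≤ w.1 → coneDist κ dL z w < ε → w ∈ f '' V)

/-! ### Geodesics, triangles, and limit segments in `Y = (E, induced path metric)` -/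

/-- The set `α` is (the image of) a geodesic arc of `Y = (E, pathDistIn E)`. -/
def IsYGeodesicArc (E : Set X) (α : Set X) : Prop :=
  ∃ (f : ℝ → X) (a b : ℝ), IsGeodesicWrt (pathDistIn E) f a b ∧
    MapsTo f (Icc a b) E ∧ f '' Icc a b = α

/-- `T` is a geodesic triangle of `Y = (E, pathDistIn E)` with vertices `p`, `q`, `r`:
the union of the three `Y`-geodesics joining the vertices. -/
def IsYTriangle (E : Set X) (T : Set X) (p q r : X) : Prop :=
  p ∈ E ∧ q ∈ E ∧ r ∈ E ∧
    T = geodSeg (pathDistIn E) E p q ∪ geodSeg (pathDistIn E) E q r ∪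
        geodSeg (pathDistIn E) E r p

/-- The set `γim` (a curve in `E`) is locally geodesic in `Y` at `p`: some subarc of `γim`
containing `p` in its relative interior is a geodesic of `Y`. -/
def LocallyYGeodesicAt (E γim : Set X) (p : X) : Prop :=
  ∃ (f : ℝ → X) (a b t : ℝ), t ∈ Ioo a b ∧ f t = p ∧
    IsGeodesicWrt (pathDistIn E) f a b ∧ MapsTo f (Icc a b) E ∧ f '' Icc a b ⊆ γim

/-- `f : [0,1] → E` is the constant-speed parametrization of the `Y`-geodesic
from `x` to `y`. -/
def IsConstSpeedYGeodesic (E : Set X) (f : ℝ → X) (x y : X) : Prop :=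
  f 0 = x ∧ f 1 = y ∧ MapsTo f (Icc 0 1) E ∧
    ∀ s ∈ Icc (0:ℝ) 1, ∀ t ∈ Icc (0:ℝ) 1,
      pathDistIn E (f s) (f t) = pathDistIn E x y * |s - t|

/-- `R` is the limit segment of length `ε` at `p` of the `Y`-geodesic side from `p` to `q`:
`R` is an `X`-geodesic of length `ε` issuing from `p`, and the `X`-geodesics of length `ε`
from `p` through `σ t` (σ the `Y`-geodesic from `p` to `q`) converge uniformly to `R`
as `t → 0⁺`. -/
def IsLimitSegment (E : Set X) (p q : X) (ε : ℝ) (R : ℝ → X) : Prop :=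
  0 < ε ∧ R 0 = p ∧ IsGeodesicWrt (fun x y : X => dist x y) R 0 ε ∧
    ∀ σ : ℝ → X, IsGeodesicFromTo (pathDistIn E) E σ p q →
      ∀ δ > 0, ∃ t₀ > 0, ∀ t, 0 < t → t ≤ t₀ → t ≤ pathDistIn E p q →
        ∀ g : ℝ → X, IsGeodesicWrt (fun x y : X => dist x y) g 0 ε → g 0 = p →
          g (dist p (σ t)) = σ t → ∀ s ∈ Icc 0 ε, dist (g s) (R s) ≤ δ

end Cat2Cx

end

noncomputable section

namespace Cat2Cx

open scoped Topology

section

/-! ### Comparison angles in curvature `κ ≤ 0` and in the Euclidean plane -/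

/-- `x ↦ cosh √x` is convex on `[0, ∞)`. -/
lemma convexOn_cosh_sqrt : ConvexOn ℝ (Ici 0) fun x : ℝ => Real.cosh (Real.sqrt x) := by
  have hs : ∀ x ∈ Ici (0 : ℝ), HasSum (fun n : ℕ => x ^ n / ((2 * n).factorial : ℝ))
      (Real.cosh (Real.sqrt x)) := by
    intro x hx
    have := Real.hasSum_cosh (Real.sqrt x)
    simpa only [pow_mul, Real.sq_sqrt (mem_Ici.1 hx)] using this
  refine ⟨convex_Ici 0, fun x hx y hy a b ha hb hab => ?_⟩
  have hz : a • x + b • y ∈ Ici (0 : ℝ) := convex_Ici 0 hx hy ha hb hab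
  refine hasSum_le (fun n => ?_) (hs _ hz) (((hs x hx).mul_left a).add ((hs y hy).mul_left b))
  have := (convexOn_pow n).2 hx hy ha hb hab
  simp only [smul_eq_mul] at this ⊢
  rw [← mul_div_assoc, ← mul_div_assoc, ← add_div]
  gcongr

lemma cosh_le_of_euclidean_law_of_cosines {a b c s : ℝ} (hc : 0 ≤ c)
    (hs : |s| ≤ 1) (h : c ^ 2 = a ^ 2 + b ^ 2 - 2 * a * b * s) :
    Real.cosh c ≤ Real.cosh a * Real.cosh b - Real.sinh a * Real.sinh b * s := by
  obtain ⟨h1, h2⟩ := abs_le.1 hs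
  obtain ⟨-, hconv⟩ := convexOn_cosh_sqrt
  have key := hconv (show (a - b) ^ 2 ∈ Ici (0 : ℝ) from mem_Ici.2 (sq_nonneg _))
    (show (a + b) ^ 2 ∈ Ici (0 : ℝ) from mem_Ici.2 (sq_nonneg _)) (show 0 ≤ (1 + s) / 2 by linarith)
    (show 0 ≤ (1 - s) / 2 by linarith) (by ring)
  simp only [smul_eq_mul] at key
  rw [show (1 + s) / 2 * (a - b) ^ 2 + (1 - s) / 2 * (a + b) ^ 2 = c ^ 2 by rw [h]; ring,
    Real.sqrt_sq hc, Real.sqrt_sq_eq_abs, Real.sqrt_sq_eq_abs, Real.cosh_abs, Real.cosh_abs,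
    Real.cosh_add, Real.cosh_sub] at key
  linarith

lemma compAngle_le_euclCompAngle {κ a b c : ℝ} (hκ : κ ≤ 0) (ha : 0 < a) (hb : 0 < b)
    (h1 : |a - b| ≤ c) (h2 : c ≤ a + b) : compAngle κ a b c ≤ euclCompAngle a b c := by
  unfold compAngle
  split_ifs with h0
  · exact le_rfl
  have hk : 0 < Real.sqrt (-κ) := Real.sqrt_pos.2 (by
    have := lt_of_le_of_ne hκ h0
    linarith)
  set k := Real.sqrt (-κ)
  have hc : 0 ≤ c := (abs_nonneg _).trans h1
  apply Real.arccos_le_arccos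
  have hs1 : 0 < Real.sinh (k * a) := Real.sinh_pos_iff.2 (by positivity)
  have hs2 : 0 < Real.sinh (k * b) := Real.sinh_pos_iff.2 (by positivity)
  rw [le_div_iff₀ (by positivity)]
  have h1' := abs_le.1 h1
  have := cosh_le_of_euclidean_law_of_cosines (a := k * a) (b := k * b) (c := k * c)
    (s := (a ^ 2 + b ^ 2 - c ^ 2) / (2 * a * b)) (by positivity)
    (by
      rw [abs_le, le_div_iff₀ (by positivity), div_le_iff₀ (by positivity)]
      constructor <;> nlinarith) (by field_simp; ring)
  linarith

/-! ### The CAT(0) inequality -/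

variable {X : Type*} [MetricSpace X]

/-- Every two points of `X` are joined by a geodesic and `X` satisfies the CAT(0) comparison
inequality between a vertex and a point of the opposite side of a triangle. -/
def IsCATZero (X : Type*) [MetricSpace X] : Prop :=
  GeodesicSpaceWrt (xDist X) univ ∧
    ∀ (p q r x : X) (t : ℝ), 0 ≤ t → t ≤ 1 → dist q x = t * dist q r →
      dist x r = (1 - t) * dist q r →
      dist p x ^ 2 ≤ (1 - t) * dist p q ^ 2 + t * dist p r ^ 2 - t * (1 - t) * dist q r ^ 2

lemma exists_forall_euclCompAngle_lt {x : X} {σ τ : ℝ → X} {a : ℝ}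
    (h : upperAngleWrt (xDist X) x σ τ < a) :
    ∃ ε > 0, ∀ s t, 0 < s → s < ε → 0 < t → t < ε →
      euclCompAngle (dist x (σ s)) (dist x (τ t)) (dist (σ s) (τ t)) < a := by
  unfold upperAngleWrt at h
  obtain ⟨_, ⟨ε, hε, rfl⟩, h'⟩ := exists_lt_of_csInf_lt (by exact ⟨_, 1, one_pos, rfl⟩) h
  refine ⟨ε, hε, fun s t hs hs' ht ht' => lt_of_le_of_lt (le_csSup ?_ ?_) h'⟩
  swap
  · exact ⟨s, t, hs, hs', ht, ht', rfl⟩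
  refine ⟨Real.pi, ?_⟩
  rintro _ ⟨s, t, -, -, -, -, rfl⟩
  exact Real.arccos_le_pi _

lemma dist_le_of_euclCompAngle_lt {s l d α : ℝ} (hs : 0 < s) (hl : 0 < l)
    (h0 : 0 ≤ α) (hα : α ≤ Real.pi) (h : euclCompAngle s (l * s) d < α) :
    d ≤ s * (1 + (l ^ 2 - 2 * l * Real.cos α) / 2) := by
  have h1 : Real.cos α < (s ^ 2 + (l * s) ^ 2 - d ^ 2) / (2 * s * (l * s)) := by
    by_contra! hcon
    have := Real.arccos_le_arccos hcon
    rw [Real.arccos_cos h0 hα] at this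
    exact absurd h (not_lt.2 this)
  rw [lt_div_iff₀ (by positivity)] at h1
  have hc := Real.cos_le_one α
  have : 0 ≤ 1 + (l ^ 2 - 2 * l * Real.cos α) / 2 := by nlinarith
  refine le_of_sq_le_sq ?_ (by positivity)
  have h2 : 0 ≤ s ^ 2 * ((l ^ 2 - 2 * l * Real.cos α) / 2) ^ 2 := by positivity
  nlinarith

lemma add_nonpos_of_upperAngle_le {x q r p : X} {σ τ ρ : ℝ → X} {A B : ℝ}
    (hσ : IsGeodesicFromTo (xDist X) univ σ x q) (hτ : IsGeodesicFromTo (xDist X) univ τ x r)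
    (hρ : IsGeodesicFromTo (xDist X) univ ρ x p) (hxq : x ≠ q) (hxr : x ≠ r) (hxp : x ≠ p)
    (hsum : dist q x + dist x r = dist q r) (hA : |A| ≤ 1) (hB : |B| ≤ 1)
    (h1 : upperAngleWrt (xDist X) x σ ρ ≤ Real.arccos A)
    (h2 : upperAngleWrt (xDist X) x τ ρ ≤ Real.arccos B) : A + B ≤ 0 := by
  by_contra! hcon
  have hlt : Real.arccos A + Real.arccos B < Real.pi := by
    have := Real.strictAntiOn_arccos (a := -B) (b := A) (abs_le.1 (by rwa [abs_neg]))
      (abs_le.1 hA) (by linarith)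
    rw [Real.arccos_neg] at this
    linarith
  set η := (Real.pi - Real.arccos A - Real.arccos B) / 3
  have hη : 0 < η := by simp only [η]; linarith
  have hA0 := Real.arccos_nonneg A
  have hB0 := Real.arccos_nonneg B
  set α := Real.arccos A + η
  set β := Real.arccos B + η
  have hαβ : α + β < Real.pi := by simp only [α, β, η]; linarith
  have hcos : 0 < Real.cos α + Real.cos β := by
    have := Real.cos_lt_cos_of_nonneg_of_le_pi (x := α) (y := Real.pi - β) (by positivity)
      (by linarith [show 0 ≤ β by positivity]) (by linarith)
    rw [Real.cos_pi_sub] at this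
    linarith
  obtain ⟨ε₁, hε₁, H1⟩ := exists_forall_euclCompAngle_lt (h1.trans_lt (by linarith : _ < α))
  obtain ⟨ε₂, hε₂, H2⟩ := exists_forall_euclCompAngle_lt (h2.trans_lt (by linarith : _ < β))
  obtain ⟨l, hl0, hl⟩ := exists_between (lt_min hcos one_pos)
  obtain ⟨hl1, hl2⟩ := lt_min_iff.1 hl
  obtain ⟨s, hs0, hs⟩ := exists_between (lt_min (lt_min hε₁ hε₂)
    (lt_min (dist_pos.2 hxq) (lt_min (dist_pos.2 hxr) (dist_pos.2 hxp))))
  simp only [lt_min_iff] at hs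
  obtain ⟨⟨hs1, hs2⟩, hsq, hsr, hsp⟩ := hs
  have hls : l * s < s := by nlinarith
  have hls0 : 0 < l * s := by positivity
  have dσ : dist x (σ s) = s := by
    have := hσ.2.2.1.2 0 ⟨le_rfl, dist_nonneg⟩ s ⟨hs0.le, hsq.le⟩
    simpa [xDist, hσ.1, abs_of_pos hs0] using this
  have dτ : dist x (τ s) = s := by
    have := hτ.2.2.1.2 0 ⟨le_rfl, dist_nonneg⟩ s ⟨hs0.le, hsr.le⟩
    simpa [xDist, hτ.1, abs_of_pos hs0] using this
  have dρ : dist x (ρ (l * s)) = l * s := by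
    have := hρ.2.2.1.2 0 ⟨le_rfl, dist_nonneg⟩ (l * s) ⟨hls0.le, (hls.trans hsp).le⟩
    rw [zero_sub, abs_neg, abs_of_pos hls0, hρ.1] at this
    exact this
  have dσq : dist (σ s) q = dist x q - s := by
    have := hσ.2.2.1.2 s ⟨hs0.le, hsq.le⟩ _ ⟨dist_nonneg, le_rfl⟩
    rw [hσ.2.1, abs_sub_comm, abs_of_pos (sub_pos.2 hsq)] at this
    exact this
  have dτr : dist (τ s) r = dist x r - s := by
    have := hτ.2.2.1.2 s ⟨hs0.le, hsr.le⟩ _ ⟨dist_nonneg, le_rfl⟩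
    rw [hτ.2.1, abs_sub_comm, abs_of_pos (sub_pos.2 hsr)] at this
    exact this
  have e1 := H1 s (l * s) hs0 hs1 hls0 (hls.trans hs1)
  have e2 := H2 s (l * s) hs0 hs2 hls0 (hls.trans hs2)
  rw [dσ, dρ] at e1
  rw [dτ, dρ] at e2
  have f1 := dist_le_of_euclCompAngle_lt hs0 hl0 (by positivity)
    (by linarith [show 0 ≤ β by positivity]) e1
  have f2 := dist_le_of_euclCompAngle_lt hs0 hl0 (by positivity)
    (by linarith [show 0 ≤ α by positivity]) e2
  have g1 : dist q r ≤
      dist q (σ s) + dist (σ s) (ρ (l * s)) + dist (ρ (l * s)) (τ s) + dist (τ s) r :=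
    (dist_triangle4 q (σ s) (τ s) r).trans (by linarith [dist_triangle (σ s) (ρ (l * s)) (τ s)])
  rw [dist_comm (ρ _), dist_comm q (σ s), dσq, dτr, ← hsum, dist_comm q x] at g1
  have : 0 < s * l * (Real.cos α + Real.cos β - l) := mul_pos (by positivity) (by linarith)
  nlinarith

lemma abs_cosine_le_one {a b c : ℝ} (ha : 0 < a) (hb : 0 < b) (h1 : |a - b| ≤ c)
    (h2 : c ≤ a + b) : |(a ^ 2 + b ^ 2 - c ^ 2) / (2 * a * b)| ≤ 1 := by
  have := abs_le.1 h1
  rw [abs_le, le_div_iff₀ (by positivity), div_le_iff₀ (by positivity)]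
  constructor <;> nlinarith

lemma abs_dist_sub_dist_le (x q p : X) : |dist x q - dist x p| ≤ dist q p := by
  rw [dist_comm x q, dist_comm x p]; exact abs_dist_sub_le q p x

lemma IsCATSpace.isCATZero {κ : ℝ} (hκ : κ ≤ 0) (hX : IsCATSpace κ X) : IsCATZero X := by
  refine ⟨hX.1, fun p q r x t ht0 ht1 hqx hxr => ?_⟩
  have hsum : dist q x + dist x r = dist q r := by rw [hqx, hxr]; ring
  rcases eq_or_ne x q with rfl | hxq
  · have : t * dist x r = 0 := by simpa using hqx.symm
    rcases mul_eq_zero.1 this with rfl | h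
    · simp
    · obtain rfl := dist_eq_zero.1 h
      simp; linarith [sq_nonneg (dist p x)]
  rcases eq_or_ne x r with rfl | hxr'
  · have h0 : (1 - t) * dist q x = 0 := by simpa using hxr.symm
    rcases mul_eq_zero.1 h0 with h | h
    · obtain rfl : t = 1 := by linarith
      simp
    · exact absurd (dist_eq_zero.1 h).symm hxq
  rcases eq_or_ne x p with rfl | hxp
  · rw [dist_self, dist_comm x q, hqx, hxr]
    have : 0 ≤ t * (1 - t) := by nlinarith
    nlinarith [sq_nonneg (dist q r)]
  rcases eq_or_ne p q with rfl | hpq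
  · rw [hqx, dist_self]; nlinarith
  rcases eq_or_ne p r with rfl | hpr
  · rw [dist_comm p x, hxr, dist_self, dist_comm p q]; nlinarith
  obtain ⟨σ, hσ⟩ := hX.1 x trivial q trivial
  obtain ⟨τ, hτ⟩ := hX.1 x trivial r trivial
  obtain ⟨ρ, hρ⟩ := hX.1 x trivial p trivial
  have a1 := (hX.2 x trivial q trivial p trivial hxq hxp hpq.symm σ ρ hσ hρ).trans
    (compAngle_le_euclCompAngle hκ (dist_pos.2 hxq) (dist_pos.2 hxp)
      (abs_dist_sub_dist_le x q p) (dist_triangle_left q p x))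
  have a2 := (hX.2 x trivial r trivial p trivial hxr' hxp hpr.symm τ ρ hτ hρ).trans
    (compAngle_le_euclCompAngle hκ (dist_pos.2 hxr') (dist_pos.2 hxp)
      (abs_dist_sub_dist_le x r p) (dist_triangle_left r p x))
  have key := add_nonpos_of_upperAngle_le hσ hτ hρ hxq hxr' hxp hsum
    (abs_cosine_le_one (dist_pos.2 hxq) (dist_pos.2 hxp)
      (abs_dist_sub_dist_le x q p) (dist_triangle_left q p x))
    (abs_cosine_le_one (dist_pos.2 hxr') (dist_pos.2 hxp)
      (abs_dist_sub_dist_le x r p) (dist_triangle_left r p x)) a1 a2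
  have h1 : 0 < dist x p := dist_pos.2 hxp
  have hq0 : 0 < dist x q := dist_pos.2 hxq
  have hr0 : 0 < dist x r := dist_pos.2 hxr'
  rw [div_add_div _ _ (by positivity) (by positivity), div_nonpos_iff] at key
  have key' := key.resolve_left (fun h => absurd h.2 (not_le.2 (by positivity)))
  have key := key'.1
  rw [dist_comm q x] at hqx
  have hD : 0 < dist q r := by
    rw [← hsum]; positivity
  have ht : 0 < t := pos_of_mul_pos_left (hqx ▸ hq0) hD.le
  have ht' : 0 < 1 - t := pos_of_mul_pos_left (hxr ▸ hr0) hD.le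
  rw [dist_comm p x, dist_comm p q, dist_comm p r]
  rw [hqx, hxr] at key
  have : 2 * dist x p * dist q r *
      (dist x p ^ 2 - ((1 - t) * dist q p ^ 2 + t * dist r p ^ 2 -
        t * (1 - t) * dist q r ^ 2)) ≤ 0 := by
    nlinarith
  by_contra! hcon
  exact absurd this (not_le.2 (mul_pos (by positivity) (by linarith)))

end

section

/-! ### Geodesics in CAT(0) spaces -/

variable {X : Type*} [MetricSpace X]

/-- The metric segment between `p` and `q`. -/
def seg (p q : X) : Set X := {z | dist p z + dist z q = dist p q}

lemma left_mem_seg (p q : X) : p ∈ seg p q := by simp [seg]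

lemma right_mem_seg (p q : X) : q ∈ seg p q := by simp [seg]

lemma seg_comm (p q : X) : seg p q = seg q p := by
  ext z
  simp only [seg, mem_ofPred_eq]
  rw [add_comm, dist_comm z q, dist_comm p z, dist_comm q p]

lemma seg_self (p : X) : seg p p = {p} := by
  ext z
  simp only [seg, mem_ofPred_eq, dist_self, dist_comm p z, mem_singleton_iff]
  constructor
  · intro h
    exact dist_eq_zero.1 (by linarith)
  · rintro rfl
    simp

lemma seg_subset_seg_left {p x z : X} (hz : z ∈ seg p x) : seg p z ⊆ seg p x := by
  intro w hw
  simp only [seg, mem_ofPred_eq] at *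
  have := dist_triangle w z x
  have := dist_triangle p w x
  linarith

lemma mem_seg_of_mem_seg {p x z w : X} (hz : z ∈ seg p x) (hw : w ∈ seg p z) : z ∈ seg w x := by
  simp only [seg, mem_ofPred_eq] at *
  have := dist_triangle w z x
  have := dist_triangle p w x
  linarith

lemma dist_le_of_mem_seg {p x z : X} (hz : z ∈ seg p x) : dist p z ≤ dist p x := by
  simp only [seg, mem_ofPred_eq] at hz
  linarith [dist_nonneg (x := z) (y := x)]

namespace IsCATZero

variable (h : IsCATZero X)
include h

lemma exists_point (p x : X) (t : unitInterval) :
    ∃ z, dist p z = t * dist p x ∧ dist z x = (1 - t) * dist p x := by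
  obtain ⟨f, hf0, hf1, hf, -⟩ := h.1 p trivial x trivial
  have ht : (t : ℝ) * dist p x ∈ Icc 0 (dist p x) :=
    ⟨mul_nonneg t.2.1 dist_nonneg, mul_le_of_le_one_left dist_nonneg t.2.2⟩
  refine ⟨f (t * dist p x), ?_, ?_⟩
  · have := hf.2 0 ⟨le_rfl, dist_nonneg⟩ _ ht
    rw [hf0, zero_sub, abs_neg, abs_of_nonneg ht.1] at this
    exact this
  · have := hf.2 _ ht _ ⟨dist_nonneg, le_rfl⟩
    rw [hf1, abs_sub_comm, abs_of_nonneg (sub_nonneg.2 ht.2)] at this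
    exact this.trans (by ring)

/-- The point dividing the geodesic from `p` to `x` in the ratio `t : 1 - t`. -/
def geo (p x : X) (t : unitInterval) : X := (h.exists_point p x t).choose

lemma dist_geo_left (p x : X) (t : unitInterval) : dist p (h.geo p x t) = t * dist p x :=
  (h.exists_point p x t).choose_spec.1

lemma dist_geo_right (p x : X) (t : unitInterval) : dist (h.geo p x t) x = (1 - t) * dist p x :=
  (h.exists_point p x t).choose_spec.2

lemma geo_mem_seg (p x : X) (t : unitInterval) : h.geo p x t ∈ seg p x := by
  simp only [seg, mem_ofPred_eq, dist_geo_left, dist_geo_right]; ring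

lemma eq_geo {p x z : X} {t : unitInterval} (h1 : dist p z = t * dist p x)
    (h2 : dist z x = (1 - t) * dist p x) : z = h.geo p x t := by
  have := h.2 (h.geo p x t) p x z t t.2.1 t.2.2 h1 h2
  rw [dist_comm _ p, dist_geo_left, dist_geo_right, dist_comm] at this
  have h0 : dist z (h.geo p x t) ^ 2 ≤ 0 := by nlinarith
  exact dist_eq_zero.1 (pow_eq_zero_iff two_ne_zero |>.1 (le_antisymm h0 (sq_nonneg _)))

lemma exists_eq_geo {p x z : X} (hz : z ∈ seg p x) : ∃ t, z = h.geo p x t := by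
  rcases eq_or_ne p x with rfl | hne
  · rw [seg_self, mem_singleton_iff] at hz
    subst hz
    exact ⟨0, h.eq_geo (by simp) (by simp)⟩
  have hd := dist_pos.2 hne
  have hle := dist_le_of_mem_seg hz
  simp only [seg, mem_ofPred_eq] at hz
  refine ⟨⟨dist p z / dist p x, by positivity, (div_le_one hd).2 hle⟩, h.eq_geo ?_ ?_⟩
  · simp only; field_simp
  · simp only; field_simp; linarith

lemma geo_zero (p x : X) : h.geo p x 0 = p := (h.eq_geo (by simp) (by simp)).symm

lemma geo_one (p x : X) : h.geo p x 1 = x := (h.eq_geo (by simp) (by simp)).symm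

lemma dist_geo_geo (p x : X) (s t : unitInterval) :
    dist (h.geo p x s) (h.geo p x t) = |(s : ℝ) - t| * dist p x := by
  apply le_antisymm
  · have := h.2 (h.geo p x s) p x (h.geo p x t) t t.2.1 t.2.2 (h.dist_geo_left _ _ _)
      (h.dist_geo_right _ _ _)
    rw [dist_comm _ p, dist_geo_left, dist_geo_right] at this
    refine le_of_sq_le_sq ?_ (by positivity)
    rw [mul_pow, sq_abs]
    nlinarith
  · have := abs_dist_sub_le (h.geo p x s) (h.geo p x t) p
    rw [dist_comm _ p, dist_comm _ p, dist_geo_left, dist_geo_left, ← sub_mul, abs_mul,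
      abs_of_nonneg dist_nonneg] at this
    exact this

lemma dist_geo_le (p x y : X) (t : unitInterval) :
    dist (h.geo p x t) (h.geo p y t) ≤ t * dist x y := by
  have h1 := h.2 (h.geo p x t) p y (h.geo p y t) t t.2.1 t.2.2 (h.dist_geo_left _ _ _)
    (h.dist_geo_right _ _ _)
  have h2 := h.2 y p x (h.geo p x t) t t.2.1 t.2.2 (h.dist_geo_left _ _ _) (h.dist_geo_right _ _ _)
  rw [dist_comm _ p, dist_geo_left] at h1
  rw [dist_comm y p, dist_comm y x, dist_comm y] at h2
  have ht := t.2.1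
  refine le_of_sq_le_sq ?_ (mul_nonneg ht dist_nonneg)
  have h3 := mul_le_mul_of_nonneg_left h2 ht
  nlinarith

lemma continuous_geo (p : X) : Continuous fun z : X × unitInterval => h.geo p z.1 z.2 := by
  rw [Metric.continuous_iff']
  rintro ⟨x, t⟩ ε hε
  have hc : Continuous fun z : X × unitInterval => dist z.1 x + |(z.2 : ℝ) - t| * dist p x := by
    fun_prop
  have := hc.continuousAt.eventually_lt continuousAt_const (x₀ := (x, t))
    (show dist x x + |(t : ℝ) - t| * dist p x < ε by simpa using hε)
  filter_upwards [this] with z hz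
  refine lt_of_le_of_lt ?_ hz
  refine (dist_triangle _ (h.geo p x z.2) _).trans (add_le_add ?_ (h.dist_geo_geo p x _ _).le)
  exact (h.dist_geo_le p z.1 x z.2).trans (mul_le_of_le_one_left dist_nonneg z.2.2.2)

lemma dist_eq_abs_of_mem_seg {p x z w : X} (hz : z ∈ seg p x) (hw : w ∈ seg p x) :
    dist z w = |dist p z - dist p w| := by
  obtain ⟨s, rfl⟩ := h.exists_eq_geo hz
  obtain ⟨t, rfl⟩ := h.exists_eq_geo hw
  rw [dist_geo_geo, dist_geo_left, dist_geo_left, ← sub_mul, abs_mul, abs_of_nonneg dist_nonneg]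

lemma mem_seg_of_dist_le {p x z w : X} (hz : z ∈ seg p x) (hw : w ∈ seg p x)
    (hle : dist p z ≤ dist p w) : z ∈ seg p w := by
  have := h.dist_eq_abs_of_mem_seg hz hw
  rw [abs_sub_comm, abs_of_nonneg (sub_nonneg.2 hle)] at this
  simp only [seg, mem_ofPred_eq]; linarith

lemma eq_of_mem_seg_of_dist_eq {p x z w : X} (hz : z ∈ seg p x) (hw : w ∈ seg p x)
    (he : dist p z = dist p w) : z = w := by
  have := h.dist_eq_abs_of_mem_seg hz hw
  rwa [he, sub_self, abs_zero, dist_eq_zero] at this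

lemma exists_mem_seg_dist_eq (p x : X) {r : ℝ} (h0 : 0 ≤ r) (hr : r ≤ dist p x) :
    ∃ z ∈ seg p x, dist p z = r := by
  rcases eq_or_ne p x with rfl | hne
  · exact ⟨p, left_mem_seg p p, by simp at hr ⊢; linarith⟩
  have hd := dist_pos.2 hne
  refine ⟨_, h.geo_mem_seg p x ⟨r / dist p x, by positivity, (div_le_one hd).2 hr⟩, ?_⟩
  rw [dist_geo_left]
  simp only; field_simp

lemma seg_subset_union {p q y : X} (hq : q ∈ seg p y) : seg p y ⊆ seg p q ∪ seg q y := by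
  intro z hz
  rcases le_total (dist p z) (dist p q) with hle | hle
  · exact Or.inl (h.mem_seg_of_dist_le hz hq hle)
  · right
    have := h.mem_seg_of_dist_le hq hz hle
    exact mem_seg_of_mem_seg hz this

lemma seg_subset_ball {p x y : X} {r : ℝ} (hx : x ∈ ball p r) (hy : y ∈ ball p r) :
    seg x y ⊆ ball p r := by
  intro z hz
  obtain ⟨t, rfl⟩ := h.exists_eq_geo hz
  have := h.2 p x y _ t t.2.1 t.2.2 (h.dist_geo_left x y t) (h.dist_geo_right x y t)
  rw [mem_ball, dist_comm] at hx hy ⊢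
  have ht := t.2.1
  have ht' := t.2.2
  have hr : 0 < r := dist_nonneg.trans_lt hx
  refine lt_of_pow_lt_pow_left₀ 2 hr.le (lt_of_le_of_lt this ?_)
  have h1 : dist p x ^ 2 < r ^ 2 := pow_lt_pow_left₀ hx dist_nonneg two_ne_zero
  have h2 : dist p y ^ 2 < r ^ 2 := pow_lt_pow_left₀ hy dist_nonneg two_ne_zero
  have h3 : 0 ≤ (t : ℝ) * (1 - t) * dist x y ^ 2 :=
    mul_nonneg (mul_nonneg ht (by linarith)) (sq_nonneg _)
  rcases lt_or_ge (t : ℝ) 1 with h4 | h4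
  · nlinarith [mul_lt_mul_of_pos_left h1 (sub_pos.2 h4), mul_le_mul_of_nonneg_left h2.le ht]
  · have h5 : (t : ℝ) = 1 := le_antisymm ht' h4
    rw [h5]; linarith

lemma contractibleSpace_of_seg_subset {S : Set X} {z : X} (hz : z ∈ S)
    (hS : ∀ x ∈ S, seg z x ⊆ S) : ContractibleSpace S := by
  rw [contractible_iff_id_nullhomotopic]
  refine ⟨⟨z, hz⟩, ⟨ContinuousMap.Homotopy.symm ⟨⟨fun w => ⟨h.geo z w.2 w.1,
    hS _ w.2.2 (h.geo_mem_seg _ _ _)⟩, ?_⟩, ?_, ?_⟩⟩⟩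
  · apply Continuous.subtype_mk
    exact (h.continuous_geo z).comp
      ((continuous_subtype_val.comp continuous_snd).prodMk continuous_fst)
  · intro x; ext; exact h.geo_zero _ _
  · intro x; ext; exact h.geo_one _ _

lemma geodSeg_eq_seg (p q : X) : geodSeg (xDist X) univ p q = seg p q := by
  ext z
  simp only [geodSeg, mem_iUnion, mem_ofPred_eq, exists_prop]
  constructor
  · rintro ⟨f, ⟨hf0, hf1, hf, -⟩, t, ht, rfl⟩
    have h1 := hf.2 0 ⟨le_rfl, dist_nonneg⟩ t ht
    have h2 := hf.2 t ht _ ⟨dist_nonneg, le_rfl⟩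
    rw [hf0, zero_sub, abs_neg, abs_of_nonneg ht.1] at h1
    rw [hf1, abs_sub_comm, abs_of_nonneg (sub_nonneg.2 ht.2)] at h2
    simp only [seg, mem_ofPred_eq, h1, h2]
    ring
  · intro hz
    obtain ⟨f, hf⟩ := h.1 p trivial q trivial
    refine ⟨f, hf, dist p z, ⟨dist_nonneg, dist_le_of_mem_seg hz⟩, ?_⟩
    obtain ⟨hf0, hf1, hf, -⟩ := hf
    have ht : dist p z ∈ Icc 0 (dist p q) := ⟨dist_nonneg, dist_le_of_mem_seg hz⟩
    have h1 := hf.2 0 ⟨le_rfl, dist_nonneg⟩ _ ht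
    have h2 := hf.2 _ ht _ ⟨dist_nonneg, le_rfl⟩
    rw [hf0, zero_sub, abs_neg, abs_of_nonneg ht.1] at h1
    rw [hf1, abs_sub_comm, abs_of_nonneg (sub_nonneg.2 ht.2)] at h2
    refine h.eq_of_mem_seg_of_dist_eq (p := p) (x := q) ?_ hz h1
    simp only [seg, mem_ofPred_eq]
    simp only [xDist] at h1 h2
    linarith

end IsCATZero

end

section

open CategoryTheory

/-! ### Additive functions on homotopy classes of paths -/

section Cocycle

variable {Y B : Type*} [TopologicalSpace Y] [TopologicalSpace B] {A : Type*} [AddCommGroup A]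

/-- A homotopy invariant function on paths, additive under concatenation. -/
structure PathCocycle (Y : Type*) [TopologicalSpace Y] (A : Type*) [AddCommGroup A] where
  toFun : ∀ {x y : Y}, Path x y → A
  map_homotopic : ∀ {x y : Y} {p q : Path x y}, p.Homotopic q → toFun p = toFun q
  map_trans : ∀ {x y z : Y} (p : Path x y) (q : Path y z), toFun (p.trans q) = toFun p + toFun q

namespace PathCocycle

/-- The pullback of a path cocycle under a continuous map. -/
def comap (Φ : PathCocycle Y A) (f : C(B, Y)) : PathCocycle B A where
  toFun p := Φ.toFun (p.map f.continuous)
  map_homotopic h := Φ.map_homotopic (h.map f)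
  map_trans p q := by rw [Path.map_trans, Φ.map_trans]

lemma map_congr (Φ : PathCocycle Y A) {x y x' y' : Y} (p : Path x y) (q : Path x' y')
    (h : ∀ t, p t = q t) : Φ.toFun p = Φ.toFun q := by
  obtain rfl : x = x' := by simpa using h 0
  obtain rfl : y = y' := by simpa using h 1
  congr 1
  ext t
  exact h t

lemma exists_potential_univ [SimplyConnectedSpace B] (Φ : PathCocycle B A) :
    ∃ g : B → A, ∀ (x y : B) (p : Path x y), Φ.toFun p = g y - g x := by
  have b : B := Classical.arbitrary B
  refine ⟨fun x => Φ.toFun (PathConnectedSpace.somePath b x), fun x y p => ?_⟩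
  rw [eq_sub_iff_add_eq', ← Φ.map_trans]
  exact Φ.map_homotopic (SimplyConnectedSpace.paths_homotopic _ _)

lemma eq_of_freeHomotopy (Φ : PathCocycle Y A) (H : C(unitInterval × unitInterval, Y))
    (hH : ∀ s, H (s, 0) = H (s, 1)) {x y : Y} (p : Path x x) (q : Path y y)
    (hp : ∀ t, p t = H (0, t)) (hq : ∀ t, q t = H (1, t)) : Φ.toFun p = Φ.toFun q := by
  have : ContractibleSpace unitInterval :=
    (convex_Icc (0 : ℝ) 1).contractibleSpace (nonempty_Icc.2 zero_le_one)
  obtain ⟨g, hg⟩ := (Φ.comap H).exists_potential_univ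
  let side (t : unitInterval) : Path ((0 : unitInterval), t) (1, t) :=
    ⟨⟨fun s => (s, t), by fun_prop⟩, rfl, rfl⟩
  let row (s : unitInterval) : Path (s, (0 : unitInterval)) (s, 1) :=
    ⟨⟨fun t => (s, t), by fun_prop⟩, rfl, rfl⟩
  have h1 : Φ.toFun p = g (0, 1) - g (0, 0) := by
    rw [← hg _ _ (row 0)]
    exact Φ.map_congr _ _ hp
  have h2 : Φ.toFun q = g (1, 1) - g (1, 0) := by
    rw [← hg _ _ (row 1)]
    exact Φ.map_congr _ _ hq
  have h3 : g (1, 0) - g (0, 0) = g (1, 1) - g (0, 1) := by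
    rw [← hg _ _ (side 0), ← hg _ _ (side 1)]
    exact Φ.map_congr _ _ fun t => hH t
  rw [h1, h2, sub_eq_sub_iff_add_eq_add]
  rw [sub_eq_sub_iff_add_eq_add] at h3
  rw [add_comm, ← h3, add_comm]

lemma eq_zero_of_loopClassH1 (Φ : PathCocycle Y A) {x : Y} {p : Path x x}
    (hp : loopClassH1 p = 1) : Φ.toFun p = 0 := by
  let F : FundamentalGroup Y x →* Multiplicative A :=
    { toFun := fun g => Multiplicative.ofAdd
        (Quotient.lift (fun p : Path x x => Φ.toFun p) (fun _ _ h => Φ.map_homotopic h) g)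
      map_one' := by
        have : Φ.toFun (Path.refl x) = 0 := by
          have := Φ.map_trans (Path.refl x) (Path.refl x)
          rw [Path.refl_trans_refl] at this
          simpa using this
        exact congrArg Multiplicative.ofAdd this
      map_mul' := by
        intro g g'
        induction g using Quotient.inductionOn with | _ a
        induction g' using Quotient.inductionOn with | _ b
        rw [mul_comm]
        exact congrArg Multiplicative.ofAdd (Φ.map_trans b a) }
  have h := congrArg (Abelianization.lift F) hp
  rw [map_one] at h
  exact h

end PathCocycle

lemma loopClassH1_eq_of_homotopic {x : Y} {p q : Path x x} (h : p.Homotopic q) :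
    loopClassH1 p = loopClassH1 q := by
  unfold loopClassH1
  rw [Quotient.sound h]

/-- The class in the abelianized fundamental group at `b` as a path cocycle. -/
lemma exists_pathCocycle (b : Y) :
    ∃ Φ : PathCocycle Y (Additive (Abelianization (FundamentalGroup Y b))),
      ∀ p : Path b b, Φ.toFun p = Additive.ofMul (loopClassH1 p) := by
  classical
  let arrow {x y : Y} (p : Path x y) : FundamentalGroupoid.mk x ⟶ FundamentalGroupoid.mk y := ⟦p⟧
  have harrow {x y z : Y} (p : Path x y) (q : Path y z) : arrow (p.trans q) = arrow p ≫ arrow q :=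
    rfl
  let η (x : Y) (h : Joined b x) := arrow h.somePath
  let of : FundamentalGroup Y b →* Abelianization (FundamentalGroup Y b) := Abelianization.of
  let cls {x y : Y} (hx : Joined b x) (hy : Joined b y) (p : Path x y) : FundamentalGroup Y b :=
    η x hx ≫ arrow p ≫ Groupoid.inv (η y hy)
  refine ⟨⟨fun {x y} p => if h : Joined b x then
    Additive.ofMul (of (cls h (h.trans ⟨p⟩) p)) else 0, ?_, ?_⟩, ?_⟩
  · intro x y p q h
    have : arrow p = arrow q := Quotient.sound h
    simp only [cls, this]
  · intro x y z p q
    by_cases h : Joined b x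
    · have h' : Joined b y := h.trans ⟨p⟩
      have h'' : Joined b z := h'.trans ⟨q⟩
      rw [dif_pos h, dif_pos h, dif_pos h', ← ofMul_mul, ← map_mul]
      have : cls h h'' (p.trans q) = cls h' h'' q * cls h h' p := by
        simp only [cls, End.mul_def, harrow, Category.assoc]
        rw [← Category.assoc (Groupoid.inv (η y h')), Groupoid.inv_comp, Category.id_comp]
      rw [this, map_mul, mul_comm, ← map_mul]
    · have h' : ¬ Joined b y := fun h' => h (h'.trans ⟨p.symm⟩)
      rw [dif_neg h, dif_neg h, dif_neg h', add_zero]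
  · intro p
    have h : Joined b b := Joined.refl b
    change (if h : Joined b b then Additive.ofMul (of (cls h (h.trans ⟨p⟩) p)) else 0) = _
    rw [dif_pos h]
    let g : FundamentalGroup Y b := η b h
    let g' : FundamentalGroup Y b := arrow p
    have : cls h h p = g⁻¹ * g' * g := by
      simp only [cls, End.mul_def]
      rfl
    have h2 : of (cls h h p) = of g' := by
      rw [this, map_mul of, map_mul of, mul_comm, ← mul_assoc, map_inv, mul_inv_cancel, one_mul]
    rw [h2]
    rfl

lemma loopClassH1_eq_one_of_map (f : C(B, Y)) {x : B} {y : Y} (p : Path x x) (q : Path y y)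
    (h : ∀ t, f (p t) = q t) (hp : loopClassH1 p = 1) : loopClassH1 q = 1 := by
  obtain ⟨Φ, hΦ⟩ := exists_pathCocycle y
  have h1 := (Φ.comap f).eq_zero_of_loopClassH1 hp
  have h2 : Φ.toFun q = 0 := by
    rw [← h1]
    exact Φ.map_congr _ _ fun t => (h t).symm
  rw [hΦ] at h2
  exact h2

lemma loopClassH1_eq_one_of_simplyConnected [SimplyConnectedSpace Y] {x : Y} (p : Path x x) :
    loopClassH1 p = 1 := by
  rw [loopClassH1_eq_of_homotopic (SimplyConnectedSpace.paths_homotopic p (Path.refl x))]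
  exact map_one (Abelianization.of (G := FundamentalGroup Y x))

end Cocycle

/-! ### Winding numbers -/

section Winding

variable {Y : Type*} [TopologicalSpace Y]

lemma circleLift_sub_eq {c : C(unitInterval, AddCircle (1 : ℝ))} {θ θ' : unitInterval → ℝ}
    (hθ : Continuous θ) (hθ' : Continuous θ') (h : ∀ t, (θ t : AddCircle (1 : ℝ)) = c t)
    (h' : ∀ t, (θ' t : AddCircle (1 : ℝ)) = c t) : θ 1 - θ 0 = θ' 1 - θ' 0 := by
  have cov := AddCircle.isCoveringMap_coe (1 : ℝ)
  have e0 : c 0 = ((θ 0 : ℝ) : AddCircle (1 : ℝ)) := (h 0).symm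
  have h1 : θ = cov.liftPath c (θ 0) e0 := (cov.eq_liftPath_iff _).2 ⟨hθ, funext h, rfl⟩
  have h2 : (fun t => θ' t + (θ 0 - θ' 0)) = cov.liftPath c (θ 0) e0 := by
    refine (cov.eq_liftPath_iff _).2 ⟨by fun_prop, funext fun t => ?_, by ring⟩
    simp [h, h']
  have := congrFun (h1.trans h2.symm) 1
  linarith

lemma exists_circleLift (c : C(unitInterval, AddCircle (1 : ℝ))) :
    ∃ θ : unitInterval → ℝ, Continuous θ ∧ ∀ t, (θ t : AddCircle (1 : ℝ)) = c t := by
  obtain ⟨e, he⟩ := QuotientAddGroup.mk_surjective (c 0)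
  obtain ⟨Γ, hΓ, -⟩ := (AddCircle.isCoveringMap_coe (1 : ℝ)).exists_path_lifts c e he.symm
  exact ⟨Γ, Γ.continuous, congrFun hΓ⟩

/-- The winding number of paths with respect to a circle-valued map. -/
def winding (f : C(Y, AddCircle (1 : ℝ))) : PathCocycle Y ℝ :=
  have cov := AddCircle.isCoveringMap_coe (1 : ℝ)
  have hchoose (c : C(unitInterval, AddCircle (1 : ℝ))) := (exists_circleLift c).choose_spec
  { toFun := fun p =>
      (exists_circleLift (f.comp p.toContinuousMap)).choose 1 -
        (exists_circleLift (f.comp p.toContinuousMap)).choose 0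
    map_homotopic := by
      intro x y p q hpq
      obtain ⟨e, he⟩ := QuotientAddGroup.mk_surjective (f x)
      have hp : (f.comp p.toContinuousMap) 0 = ((e : ℝ) : AddCircle (1 : ℝ)) := by
        simpa using he.symm
      have hq : (f.comp q.toContinuousMap) 0 = ((e : ℝ) : AddCircle (1 : ℝ)) := by
        simpa using he.symm
      have key := cov.liftPath_apply_one_eq_of_homotopicRel
        (ContinuousMap.HomotopicRel.comp_continuousMap hpq f) e hp hq
      rw [circleLift_sub_eq (hchoose _).1 (cov.liftPath _ e hp).continuous (hchoose _).2
          (congrFun (cov.liftPath_lifts _ e hp)),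
        circleLift_sub_eq (hchoose _).1 (cov.liftPath _ e hq).continuous (hchoose _).2
          (congrFun (cov.liftPath_lifts _ e hq)), key, cov.liftPath_zero, cov.liftPath_zero]
    map_trans := by
      intro x y z p q
      obtain ⟨θ, hθ, hθ'⟩ := exists_circleLift (f.comp p.toContinuousMap)
      have h1 : (f.comp q.toContinuousMap) 0 = ((θ 1 : ℝ) : AddCircle (1 : ℝ)) := by simp [hθ']
      obtain ⟨Γ, hΓ, hΓ0⟩ := cov.exists_path_lifts (f.comp q.toContinuousMap) (θ 1) h1
      let P : Path (θ 0) (θ 1) := ⟨⟨θ, hθ⟩, rfl, rfl⟩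
      let Q : Path (θ 1) (Γ 1) := ⟨Γ, hΓ0, rfl⟩
      rw [circleLift_sub_eq (hchoose _).1 hθ (hchoose _).2 hθ',
        circleLift_sub_eq (hchoose _).1 Γ.continuous (hchoose _).2 (congrFun hΓ),
        circleLift_sub_eq (hchoose _).1 (P.trans Q).continuous (hchoose _).2 fun t => ?_]
      · simp [hΓ0]
      · simp only [Path.trans_apply, ContinuousMap.comp_apply]
        change _ = f ((p.trans q) t)
        rw [Path.trans_apply]
        split_ifs
        · exact hθ' _
        · exact congrFun hΓ _ }

lemma winding_eq (f : C(Y, AddCircle (1 : ℝ))) {x y : Y} (p : Path x y) {θ : unitInterval → ℝ}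
    (hθ : Continuous θ) (h : ∀ t, (θ t : AddCircle (1 : ℝ)) = f (p t)) :
    (winding f).toFun p = θ 1 - θ 0 :=
  circleLift_sub_eq (exists_circleLift (f.comp p.toContinuousMap)).choose_spec.1 hθ
    (exists_circleLift (f.comp p.toContinuousMap)).choose_spec.2 h

end Winding

end

section

open scoped commutatorElement
open CategoryTheory

/-! ### Nullhomologous simple closed curves -/

namespace SCC

variable {X : Type*} [MetricSpace X] {γ : SCC X} {B B' : Set X}

lemma NullhomologousIn.of_map (h : γ.NullhomologousIn B) (hB : γ.img ⊆ B) {f : X → X}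
    (hf : ContinuousOn f B) (hmaps : MapsTo f B B') (hfix : ∀ x ∈ γ.img, f x = x) :
    γ.NullhomologousIn B' := by
  intro hB'
  refine loopClassH1_eq_one_of_map (⟨hmaps.restrict, hf.mapsToRestrict hmaps⟩ : C(B, B'))
    (γ.pathIn B hB) _ (fun t => ?_) (h hB)
  exact Subtype.ext (hfix _ ⟨t, t.2, rfl⟩)

lemma NullhomologousIn.mono (h : γ.NullhomologousIn B) (hB : γ.img ⊆ B) (hBB' : B ⊆ B') :
    γ.NullhomologousIn B' :=
  h.of_map hB continuousOn_id (fun _ hx => hBB' hx) fun _ _ => rfl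

lemma nullhomologousIn_of_contractibleSpace (h : ContractibleSpace B) : γ.NullhomologousIn B :=
  fun _ => loopClassH1_eq_one_of_simplyConnected _

lemma isCompact_img (γ : SCC X) : IsCompact γ.img := isCompact_Icc.image_of_continuousOn γ.contOn

end SCC

section Compactness

variable {X : Type*} [MetricSpace X]

lemma exists_pos_forall_le_dist {K : Type*} [TopologicalSpace K] [CompactSpace K] {x : X}
    (f : K → X) (hf : Continuous f) (hx : ∀ k, f k ≠ x) : ∃ r > 0, ∀ k, r ≤ dist (f k) x := by
  have hc : IsCompact (range f) := isCompact_range hf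
  obtain ⟨r, hr, h⟩ := Metric.mem_nhds_iff.1
    (hc.isClosed.isOpen_compl.mem_nhds (show x ∈ (range f)ᶜ by rintro ⟨k, hk⟩; exact hx k hk))
  refine ⟨r, hr, fun k => not_lt.1 fun hlt => h (mem_ball.2 hlt) ⟨k, rfl⟩⟩

/-- The inclusion of the complement of a ball into the complement of its center. -/
def complBallIncl (x : X) {r : ℝ} (hr : 0 < r) : C({y : X | r ≤ dist y x}, ({x}ᶜ : Set X)) :=
  ⟨fun y => ⟨y, fun h => by
    have h1 : (y : X) = x := h
    have h2 : r ≤ dist (y : X) x := y.2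
    rw [h1, dist_self] at h2
    linarith⟩, by fun_prop⟩

lemma exists_mem_commutator_complBall {x : X} {b : ({x}ᶜ : Set X)}
    {g : FundamentalGroup ({x}ᶜ : Set X) b} (hg : g ∈ commutator (FundamentalGroup _ b)) :
    ∃ r₀ > 0, ∀ r (hr : 0 < r) (hb : r ≤ dist (b : X) x), r ≤ r₀ →
      ∃ g' ∈ commutator (FundamentalGroup {y : X | r ≤ dist y x} ⟨b, hb⟩),
        FundamentalGroup.map (complBallIncl x hr) ⟨b, hb⟩ g' = g := by
  rw [commutator_eq_closure] at hg
  induction hg using Subgroup.closure_induction with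
  | mem g hg =>
    obtain ⟨g₁, g₂, rfl⟩ := hg
    have lift : ∀ g : FundamentalGroup ({x}ᶜ : Set X) b, ∃ r₀ > 0, ∀ r (hr : 0 < r)
        (hb : r ≤ dist (b : X) x), r ≤ r₀ →
        ∃ g' : FundamentalGroup {y : X | r ≤ dist y x} ⟨b, hb⟩,
          FundamentalGroup.map (complBallIncl x hr) ⟨b, hb⟩ g' = g := by
      intro g
      induction g using Quotient.inductionOn with | _ p
      obtain ⟨r₀, hr₀, h⟩ := exists_pos_forall_le_dist (x := x) (fun t => (p t : X))
        (by fun_prop) fun t => (p t).2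
      refine ⟨r₀, hr₀, fun r hr hb hle =>
        ⟨⟦⟨⟨fun t => ⟨p t, hle.trans (h t)⟩, by fun_prop⟩, ?_, ?_⟩⟧,
        ?_⟩⟩
      · simp
      · simp
      · rfl
    obtain ⟨r₁, hr₁, h₁⟩ := lift g₁
    obtain ⟨r₂, hr₂, h₂⟩ := lift g₂
    refine ⟨min r₁ r₂, lt_min hr₁ hr₂, fun r hr hb hle => ?_⟩
    obtain ⟨a, rfl⟩ := h₁ r hr hb (hle.trans (min_le_left _ _))
    obtain ⟨c, rfl⟩ := h₂ r hr hb (hle.trans (min_le_right _ _))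
    refine ⟨⁅a, c⁆, ?_, map_commutatorElement _ _ _⟩
    exact Subgroup.commutator_mem_commutator trivial trivial
  | one => exact ⟨1, one_pos, fun r hr hb _ => ⟨1, one_mem _, map_one _⟩⟩
  | mul g₁ g₂ _ _ h₁ h₂ =>
    obtain ⟨r₁, hr₁, h₁⟩ := h₁
    obtain ⟨r₂, hr₂, h₂⟩ := h₂
    refine ⟨min r₁ r₂, lt_min hr₁ hr₂, fun r hr hb hle => ?_⟩
    obtain ⟨a, ha, rfl⟩ := h₁ r hr hb (hle.trans (min_le_left _ _))
    obtain ⟨c, hc, rfl⟩ := h₂ r hr hb (hle.trans (min_le_right _ _))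
    exact ⟨a * c, mul_mem ha hc, map_mul _ _ _⟩
  | inv g _ h =>
    obtain ⟨r₀, hr₀, h⟩ := h
    refine ⟨r₀, hr₀, fun r hr hb hle => ?_⟩
    obtain ⟨a, ha, rfl⟩ := h r hr hb hle
    exact ⟨a⁻¹, inv_mem ha, map_inv _ _⟩

lemma SCC.NullhomologousIn.exists_ball {γ : SCC X} {x : X} (hx : x ∉ γ.img)
    (h : γ.NullhomologousIn {x}ᶜ) : ∃ r > 0, ∀ y ∈ ball x r, γ.NullhomologousIn {y}ᶜ := by
  have hsub : γ.img ⊆ {x}ᶜ := fun z hz hzx => hx (by rwa [← mem_singleton_iff.1 hzx])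
  have h1 := h hsub
  obtain ⟨r₀, hr₀, hγ⟩ := exists_pos_forall_le_dist (x := x)
    (fun t => (γ.pathIn _ hsub t : X))
    (continuous_subtype_val.comp (γ.pathIn _ hsub).continuous) fun t => (γ.pathIn _ hsub t).2
  have hb : r₀ ≤ dist (γ.basePoint _ hsub : X) x := by simpa using hγ 0
  have hmem : FundamentalGroup.fromPath (X := TopCat.of ({x}ᶜ : Set X)) ⟦γ.pathIn _ hsub⟧ ∈
      commutator (FundamentalGroup ({x}ᶜ : Set X) (γ.basePoint _ hsub)) := by
    rw [← Abelianization.ker_of]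
    exact h1
  obtain ⟨r₁, hr₁, H⟩ := exists_mem_commutator_complBall hmem
  have hr₂ : 0 < min r₀ r₁ := lt_min hr₀ hr₁
  obtain ⟨g', hg', hmap⟩ := H _ hr₂ ((min_le_left _ _).trans hb) (min_le_right _ _)
  rw [← Abelianization.ker_of] at hg'
  induction g' using Quotient.inductionOn with | _ p
  obtain ⟨K⟩ : (p.map (complBallIncl x hr₂).continuous).Homotopic (γ.pathIn _ hsub) :=
    Quotient.exact hmap
  obtain ⟨r, hr, hK⟩ := exists_pos_forall_le_dist (x := x) (fun t => (K t : X))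
    (by fun_prop) fun t => (K t).2
  refine ⟨min r (min r₀ r₁), lt_min hr hr₂, fun y hy => ?_⟩
  set ρ := min r (min r₀ r₁)
  have hρ : ρ ≤ min r₀ r₁ := min_le_right _ _
  have hsub' : γ.img ⊆ {z | ρ ≤ dist z x} := by
    rintro _ ⟨t, ht, rfl⟩
    exact (hρ.trans (min_le_left _ _)).trans (hγ ⟨t, ht⟩)
  have hnull : γ.NullhomologousIn {z | ρ ≤ dist z x} := by
    intro h'
    have e1 : loopClassH1 p = 1 := hg'
    let f : C({z : X | min r₀ r₁ ≤ dist z x}, {z : X | ρ ≤ dist z x}) :=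
      ⟨fun z => ⟨z, hρ.trans z.2⟩, by fun_prop⟩
    have e2 := loopClassH1_eq_one_of_map f p (p.map f.continuous) (fun t => rfl) e1
    refine Eq.trans (loopClassH1_eq_of_homotopic ?_) e2
    refine Path.Homotopic.symm
      ⟨⟨⟨⟨fun t => ⟨K t, (min_le_left _ _).trans (hK t)⟩, by fun_prop⟩, ?_, ?_⟩, ?_⟩⟩
    · intro t
      apply Subtype.ext
      simp
      rfl
    · intro t
      apply Subtype.ext
      simp
      rfl
    · intro t s hs
      apply Subtype.ext
      have := congrArg Subtype.val (K.prop t s hs)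
      exact this
  refine hnull.mono hsub' fun z hz hzy => ?_
  rw [mem_singleton_iff.1 hzy] at hz
  exact absurd (mem_ball.1 hy) (not_lt.2 hz)

end Compactness

end

section

/-! ### Projective models of the model planes -/

lemma add_eq_of_mem_geodSeg {Z : Type*} {d : Z → Z → ℝ} {u v z : Z}
    (hz : z ∈ geodSeg d univ u v) : d u z + d z v = d u v := by
  simp only [geodSeg, mem_iUnion, mem_ofPred_eq, exists_prop] at hz
  obtain ⟨f, ⟨hf0, hf1, hf, -⟩, t, ht, rfl⟩ := hz
  have h0 : (0 : ℝ) ∈ Icc 0 (d u v) := ⟨le_rfl, hf.1⟩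
  have h1 := hf.2 0 h0 t ht
  have h2 := hf.2 t ht _ ⟨hf.1, le_rfl⟩
  rw [hf0, zero_sub, abs_neg, abs_of_nonneg ht.1] at h1
  rw [hf1, abs_sub_comm, abs_of_nonneg (sub_nonneg.2 ht.2)] at h2
  rw [h1, h2]; ring

lemma convexWrt_convexHullWrt {Z : Type*} (d : Z → Z → ℝ) (A : Set Z) :
    ConvexWrt d (convexHullWrt d A) := by
  intro x hx y hy z hz C hC
  exact hC.1 x (hx C hC) y (hy C hC) hz

/-- `k` is a chart of `M_κ²` onto an open subset of the affine plane taking geodesics to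
straight segments. -/
structure IsProjectiveModel (κ : ℝ) (k : ℝ × ℝ → ℝ × ℝ) : Prop where
  isOpenEmbedding : Topology.IsOpenEmbedding k
  exists_modulus : ∃ g : ℝ → ℝ, Tendsto g (𝓝 0) (𝓝 0) ∧ ∀ u v, ‖k u - k v‖ ≤ g (mDist κ u v)
  continuous_mDist : Continuous fun p : (ℝ × ℝ) × (ℝ × ℝ) => mDist κ p.1 p.2
  mDist_self : ∀ u, mDist κ u u = 0
  exists_mem_geodSeg : ∀ u v, ∀ w ∈ segment ℝ (k u) (k v),
    ∃ z ∈ geodSeg (mDist κ) univ u v, k z = w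

lemma norm_le_sqrt_sq_add_sq (u : ℝ × ℝ) : ‖u‖ ≤ Real.sqrt (u.1 ^ 2 + u.2 ^ 2) := by
  rw [Prod.norm_def]
  refine max_le ?_ ?_ <;> rw [Real.norm_eq_abs] <;> apply Real.abs_le_sqrt <;>
    nlinarith [sq_nonneg u.1, sq_nonneg u.2]

lemma isProjectiveModel_id : IsProjectiveModel 0 id where
  isOpenEmbedding := Topology.IsOpenEmbedding.id
  exists_modulus := ⟨id, tendsto_id, fun u v => by
    simpa [mDist] using norm_le_sqrt_sq_add_sq (u - v)⟩
  continuous_mDist := by simp only [mDist, if_true]; fun_prop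
  mDist_self := by simp [mDist]
  exists_mem_geodSeg := by
    intro u v w hw
    simp only [id, exists_eq_right] at hw ⊢
    obtain ⟨l, hl, rfl⟩ := (segment_eq_image_lineMap ℝ u v) ▸ hw
    have hd : ∀ a b : ℝ, mDist 0 (AffineMap.lineMap u v a) (AffineMap.lineMap u v b) =
        |a - b| * mDist 0 u v := by
      intro a b
      simp only [mDist, if_true]
      rw [← Real.sqrt_sq_eq_abs, ← Real.sqrt_mul (sq_nonneg _)]
      congr 1
      simp [AffineMap.lineMap_apply]
      ring
    have hnn : 0 ≤ mDist 0 u v := by simp only [mDist, if_true]; positivity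
    set D := mDist 0 u v
    have hval : ∀ s, 0 ≤ s → s ≤ D → s / D * D = s := by
      intro s h0 hs
      rcases eq_or_ne D 0 with h | h
      · rw [h] at hs ⊢; simp; linarith
      · field_simp
    have h1 : AffineMap.lineMap u v (D / D) = v := by
      rcases eq_or_ne D 0 with h | h
      · have h' : Real.sqrt ((u.1 - v.1) ^ 2 + (u.2 - v.2) ^ 2) = 0 := by
          simpa [D, mDist] using h
        rw [Real.sqrt_eq_zero (by positivity)] at h'
        have e1 : u.1 = v.1 := by nlinarith [sq_nonneg (u.1 - v.1), sq_nonneg (u.2 - v.2)]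
        have e2 : u.2 = v.2 := by nlinarith [sq_nonneg (u.1 - v.1), sq_nonneg (u.2 - v.2)]
        rw [Prod.ext e1 e2]; simp
      · rw [div_self h]; simp
    simp only [geodSeg, mem_iUnion, mem_ofPred_eq, exists_prop]
    refine ⟨fun s => AffineMap.lineMap u v (s / D), ⟨by simp, h1, ⟨hnn, fun s hs t ht => ?_⟩,
      fun _ _ => trivial⟩, ?_⟩
    · rw [hd, ← abs_of_nonneg hnn, ← abs_mul, sub_mul, abs_of_nonneg hnn, hval s hs.1 hs.2,
        hval t ht.1 ht.2]
    · rcases eq_or_ne D 0 with h | h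
      · refine ⟨0, ⟨le_rfl, hnn⟩, ?_⟩
        rw [h, div_zero, AffineMap.lineMap_apply_zero] at h1
        simp [h1]
      · exact ⟨l * D, ⟨mul_nonneg hl.1 hnn, mul_le_of_le_one_left hnn hl.2⟩, by
          simp only [mul_div_cancel_right₀ l h]⟩

/-- The time coordinate on the hyperboloid. -/
def hypT (u : ℝ × ℝ) : ℝ := Real.sqrt (1 + u.1 ^ 2 + u.2 ^ 2)

lemma hypT_sq (u : ℝ × ℝ) : hypT u ^ 2 = 1 + u.1 ^ 2 + u.2 ^ 2 := Real.sq_sqrt (by positivity)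

lemma one_le_hypT (u : ℝ × ℝ) : 1 ≤ hypT u := by
  rw [hypT, Real.one_le_sqrt]; nlinarith [sq_nonneg u.1, sq_nonneg u.2]

/-- The Lorentz form on the hyperboloid. -/
def hypB (u v : ℝ × ℝ) : ℝ := hypT u * hypT v - u.1 * v.1 - u.2 * v.2

lemma one_le_hypB (u v : ℝ × ℝ) : 1 ≤ hypB u v := by
  have : |1 + u.1 * v.1 + u.2 * v.2| ≤ hypT u * hypT v := by
    refine abs_le_of_sq_le_sq ?_ (mul_nonneg (Real.sqrt_nonneg _) (Real.sqrt_nonneg _))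
    rw [mul_pow, hypT_sq, hypT_sq]
    nlinarith [sq_nonneg (u.1 - v.1), sq_nonneg (u.2 - v.2), sq_nonneg (u.1 * v.2 - u.2 * v.1)]
  have := (abs_le.1 this).2
  simp only [hypB]; linarith

lemma arcosh_eq : arcosh = Real.arcosh := rfl

lemma mDist_of_neg {κ : ℝ} (hκ : κ < 0) (u v : ℝ × ℝ) :
    mDist κ u v = 1 / Real.sqrt (-κ) * Real.arcosh (hypB u v) := by
  rw [mDist, if_neg hκ.ne, arcosh_eq]; rfl

/-- The Klein map of the hyperboloid onto the open unit disc. -/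
def klein (u : ℝ × ℝ) : ℝ × ℝ := (u.1 / hypT u, u.2 / hypT u)

lemma continuous_hypT : Continuous hypT := by unfold hypT; fun_prop

lemma continuous_klein : Continuous klein := by
  unfold klein
  have h := continuous_hypT
  have : ∀ u, hypT u ≠ 0 := fun u => (zero_lt_one.trans_le (one_le_hypT u)).ne'
  fun_prop (disch := assumption)

/-- The inverse of the Klein map. -/
def kleinInv (w : ℝ × ℝ) : ℝ × ℝ :=
  (w.1 / Real.sqrt (1 - w.1 ^ 2 - w.2 ^ 2), w.2 / Real.sqrt (1 - w.1 ^ 2 - w.2 ^ 2))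

lemma one_sub_klein_sq (u : ℝ × ℝ) :
    1 - (klein u).1 ^ 2 - (klein u).2 ^ 2 = (hypT u)⁻¹ ^ 2 := by
  have h := one_le_hypT u
  have h2 := hypT_sq u
  simp only [klein]
  field_simp
  linarith

lemma kleinInv_klein (u : ℝ × ℝ) : kleinInv (klein u) = u := by
  have h := one_le_hypT u
  rw [kleinInv, one_sub_klein_sq, Real.sqrt_sq (by positivity)]
  ext <;> simp only [klein] <;> field_simp

lemma klein_kleinInv {w : ℝ × ℝ} (hw : 0 < 1 - w.1 ^ 2 - w.2 ^ 2) : klein (kleinInv w) = w := by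
  have hs := Real.sqrt_pos.2 hw
  have h : hypT (kleinInv w) = (Real.sqrt (1 - w.1 ^ 2 - w.2 ^ 2))⁻¹ := by
    rw [hypT, ← Real.sqrt_inv]
    congr 1
    simp only [kleinInv, div_pow, Real.sq_sqrt hw.le]
    field_simp
    ring
  rw [klein, h]
  ext <;> simp only [kleinInv] <;> field_simp

lemma isOpenEmbedding_klein : Topology.IsOpenEmbedding klein := by
  refine .of_continuous_injective_isOpenMap continuous_klein
    (Function.LeftInverse.injective kleinInv_klein) fun U hU => ?_
  have hD : IsOpen {w : ℝ × ℝ | 0 < 1 - w.1 ^ 2 - w.2 ^ 2} :=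
    isOpen_lt continuous_const (by fun_prop)
  have hc : ContinuousOn kleinInv {w : ℝ × ℝ | 0 < 1 - w.1 ^ 2 - w.2 ^ 2} := by
    have h0 : ∀ w ∈ {w : ℝ × ℝ | 0 < 1 - w.1 ^ 2 - w.2 ^ 2},
        Real.sqrt (1 - w.1 ^ 2 - w.2 ^ 2) ≠ 0 := fun w hw => (Real.sqrt_pos.2 hw).ne'
    have hn : Continuous fun w : ℝ × ℝ => Real.sqrt (1 - w.1 ^ 2 - w.2 ^ 2) := by fun_prop
    exact (continuous_fst.continuousOn.div hn.continuousOn h0).prodMk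
      (continuous_snd.continuousOn.div hn.continuousOn h0)
  convert hc.isOpen_inter_preimage hD hU using 1
  ext w
  constructor
  · rintro ⟨u, hu, rfl⟩
    refine ⟨?_, ?_⟩
    · have := one_le_hypT u
      simp only [mem_ofPred_eq, one_sub_klein_sq]; positivity
    · simpa [kleinInv_klein] using hu
  · rintro ⟨hw, hwU⟩
    exact ⟨_, hwU, klein_kleinInv hw⟩

lemma norm_klein_sub_le (u v : ℝ × ℝ) : ‖klein u - klein v‖ ≤ Real.sqrt (hypB u v ^ 2 - 1) := by
  refine (norm_le_sqrt_sq_add_sq _).trans (Real.sqrt_le_sqrt ?_)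
  have ha := one_le_hypT u
  have hb := one_le_hypT v
  have ha2 := hypT_sq u
  have hb2 := hypT_sq v
  simp only [klein, hypB, Prod.fst_sub, Prod.snd_sub]
  set a := hypT u
  set b := hypT v
  have hN : (u.1 / a - v.1 / b) ^ 2 + (u.2 / a - v.2 / b) ^ 2 =
      ((b * u.1 - a * v.1) ^ 2 + (b * u.2 - a * v.2) ^ 2) / (a ^ 2 * b ^ 2) := by
    field_simp
  set N := (b * u.1 - a * v.1) ^ 2 + (b * u.2 - a * v.2) ^ 2
  have hN0 : 0 ≤ N := by positivity
  have h1 : (a * b - u.1 * v.1 - u.2 * v.2) ^ 2 - 1 = N - (u.1 * v.2 - u.2 * v.1) ^ 2 := by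
    simp only [N]
    linear_combination (b ^ 2 - v.1 ^ 2 - v.2 ^ 2) * ha2 + hb2
  have h2 : a ^ 2 * (u.1 * v.2 - u.2 * v.1) ^ 2 ≤ (u.1 ^ 2 + u.2 ^ 2) * N := by
    simp only [N]
    nlinarith [sq_nonneg (u.1 * (b * u.1 - a * v.1) + u.2 * (b * u.2 - a * v.2))]
  rw [hN, h1, div_le_iff₀ (by positivity)]
  have h3 : N ≤ a ^ 2 * (N - (u.1 * v.2 - u.2 * v.1) ^ 2) := by nlinarith
  have h4 : 0 ≤ a ^ 2 * (N - (u.1 * v.2 - u.2 * v.1) ^ 2) := hN0.trans h3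
  nlinarith [mul_le_mul_of_nonneg_left (show 1 ≤ b ^ 2 by nlinarith) h4]

end

section

lemma sinh_sub_combination (D x y : ℝ) :
    Real.sinh (D - x) * Real.sinh (D - y) + Real.sinh x * Real.sinh y +
      (Real.sinh (D - x) * Real.sinh y + Real.sinh x * Real.sinh (D - y)) * Real.cosh D =
    Real.sinh D ^ 2 * Real.cosh (x - y) := by
  rw [Real.sinh_sub, Real.sinh_sub, Real.cosh_sub]
  linear_combination (-Real.sinh x * Real.sinh y) * Real.cosh_sq D

lemma hypT_add {u v : ℝ × ℝ} {p r : ℝ} (hp : 0 ≤ p) (hr : 0 ≤ r)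
    (h : p ^ 2 + r ^ 2 + 2 * (p * r) * hypB u v = 1) :
    hypT (p • u + r • v) = p * hypT u + r * hypT v := by
  have ha := one_le_hypT u
  have hb := one_le_hypT v
  rw [hypT, Real.sqrt_eq_iff_mul_self_eq (by positivity) (by positivity)]
  simp only [hypB] at h
  simp only [Prod.fst_add, Prod.snd_add, Prod.smul_fst, Prod.smul_snd, smul_eq_mul]
  linear_combination -(p ^ 2) * hypT_sq u - r ^ 2 * hypT_sq v - h

lemma exists_mem_geodSeg_klein {κ : ℝ} (hκ : κ < 0) (u v w : ℝ × ℝ)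
    (hw : w ∈ segment ℝ (klein u) (klein v)) :
    ∃ z ∈ geodSeg (mDist κ) univ u v, klein z = w := by
  have hk : 0 < Real.sqrt (-κ) := Real.sqrt_pos.2 (neg_pos.2 hκ)
  have hmD := mDist_of_neg hκ u v
  set k := Real.sqrt (-κ)
  set D := Real.arcosh (hypB u v) with hD
  have hD0 : 0 ≤ D := Real.arcosh_nonneg (one_le_hypB u v)
  have hcosh : Real.cosh D = hypB u v := Real.cosh_arcosh (one_le_hypB u v)
  simp only [geodSeg, mem_iUnion, mem_ofPred_eq, exists_prop]
  rcases hD0.eq_or_lt with h0 | h0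
  · have h1 := norm_klein_sub_le u v
    rw [← hcosh, ← h0] at h1
    have h2 : klein u = klein v := by simpa [sub_eq_zero] using h1
    have h3 : u = v := isOpenEmbedding_klein.injective h2
    subst h3
    have hm : mDist κ u u = 0 := by rw [hmD, ← h0, mul_zero]
    refine ⟨u, ⟨fun _ => u, ⟨rfl, rfl, ⟨hm.ge, fun s hs t ht => ?_⟩, fun _ _ => trivial⟩, 0,
      ⟨le_rfl, hm.ge⟩, rfl⟩, by rw [segment_same] at hw; exact hw.symm⟩
    rw [hm] at hs ht ⊢
    rw [le_antisymm hs.2 hs.1, le_antisymm ht.2 ht.1]; simp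
  have hS : 0 < Real.sinh D := Real.sinh_pos_iff.2 h0
  have hkm : k * mDist κ u v = D := by rw [hmD]; field_simp
  set m := mDist κ u v
  have hm0 : 0 ≤ m := by rw [hmD]; positivity
  set P : ℝ → ℝ := fun s => Real.sinh (D - k * s) / Real.sinh D with hP
  set R : ℝ → ℝ := fun s => Real.sinh (k * s) / Real.sinh D with hR
  have hP0 : ∀ s ∈ Icc 0 m, 0 ≤ P s := fun s hs => by
    refine div_nonneg (Real.sinh_nonneg_iff.2 ?_) hS.le
    rw [← hkm, ← mul_sub]
    exact mul_nonneg hk.le (sub_nonneg.2 hs.2)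
  have hR0 : ∀ s ∈ Icc 0 m, 0 ≤ R s := fun s hs =>
    div_nonneg (Real.sinh_nonneg_iff.2 (mul_nonneg hk.le hs.1)) hS.le
  have hcomb : ∀ s t, P s * P t + R s * R t + (P s * R t + R s * P t) * hypB u v =
      Real.cosh (k * s - k * t) := by
    intro s t
    have := sinh_sub_combination D (k * s) (k * t)
    simp only [hP, hR, ← hcosh]
    generalize Real.cosh (k * s - k * t) = c at this ⊢
    field_simp
    linear_combination this
  have hT : ∀ s ∈ Icc 0 m, hypT (P s • u + R s • v) = P s * hypT u + R s * hypT v := by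
    intro s hs
    refine hypT_add (hP0 s hs) (hR0 s hs) ?_
    have := hcomb s s
    rw [sub_self, Real.cosh_zero] at this
    linear_combination this
  have hB : ∀ s ∈ Icc 0 m, ∀ t ∈ Icc 0 m,
      hypB (P s • u + R s • v) (P t • u + R t • v) = Real.cosh (k * s - k * t) := by
    intro s hs t ht
    rw [← hcomb, hypB, hT s hs, hT t ht]
    simp only [hypB, Prod.fst_add, Prod.snd_add, Prod.smul_fst, Prod.smul_snd, smul_eq_mul]
    linear_combination (P s * P t) * hypT_sq u + (R s * R t) * hypT_sq v
  have hP_0 : P 0 = 1 := by simp [hP, hS.ne']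
  have hR_0 : R 0 = 0 := by simp [hR]
  have hP_m : P m = 0 := by simp [hP, hkm]
  have hR_m : R m = 1 := by simp [hR, hkm, hS.ne']
  have hden : ∀ s ∈ Icc 0 m, 0 < P s * hypT u + R s * hypT v := fun s hs => by
    rw [← hT s hs]; exact zero_lt_one.trans_le (one_le_hypT _)
  have hcont : ContinuousOn (fun s => R s * hypT v / (P s * hypT u + R s * hypT v)) (Icc 0 m) := by
    refine ContinuousOn.div ?_ ?_ fun s hs => (hden s hs).ne'
    · simp only [hR]; fun_prop
    · simp only [hR, hP]; fun_prop
  obtain ⟨l, hl, rfl⟩ := (segment_eq_image_lineMap ℝ (klein u) (klein v)) ▸ hw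
  have hv := one_le_hypT v
  have hu := one_le_hypT u
  obtain ⟨s, hs, hsl⟩ : l ∈ (fun s => R s * hypT v / (P s * hypT u + R s * hypT v)) '' Icc 0 m := by
    refine intermediate_value_Icc hm0 hcont ?_
    simp only [hP_0, hR_0, hP_m, hR_m]
    have : hypT v ≠ 0 := by positivity
    simpa [this] using hl
  refine ⟨_, ⟨fun s => P s • u + R s • v, ⟨by simp [hP_0, hR_0], by
    change P m • u + R m • v = v
    simp [hP_m, hR_m],
    ⟨hm0, fun s hs t ht => ?_⟩, fun _ _ => trivial⟩, s, hs, rfl⟩, ?_⟩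
  · rw [mDist_of_neg hκ, hB s hs t ht, ← Real.cosh_abs, Real.arcosh_cosh (abs_nonneg _), ← mul_sub,
      abs_mul, abs_of_pos hk]
    change 1 / k * (k * |s - t|) = |s - t|
    field_simp
  · have hd := hden s hs
    rw [klein, hT s hs, ← hsl]
    ext <;> simp [AffineMap.lineMap_apply, klein] <;> field_simp <;> ring

lemma isProjectiveModel_klein {κ : ℝ} (hκ : κ < 0) : IsProjectiveModel κ klein where
  isOpenEmbedding := isOpenEmbedding_klein
  exists_modulus := by
    have hk : 0 < Real.sqrt (-κ) := Real.sqrt_pos.2 (neg_pos.2 hκ)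
    refine ⟨fun d => Real.sinh (Real.sqrt (-κ) * d), ?_, fun u v => ?_⟩
    · have : Continuous fun d => Real.sinh (Real.sqrt (-κ) * d) := by fun_prop
      simpa using this.tendsto 0
    · beta_reduce
      rw [mDist_of_neg hκ, ← mul_assoc, mul_one_div_cancel hk.ne', one_mul,
        Real.sinh_arcosh (one_le_hypB u v)]
      exact norm_klein_sub_le u v
  continuous_mDist := by
    simp only [mDist_of_neg hκ]
    refine continuous_const.mul (Real.continuousOn_arcosh.comp_continuous ?_
      fun p => one_le_hypB p.1 p.2)
    have := continuous_hypT
    unfold hypB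
    fun_prop
  mDist_self u := by
    have : hypB u u = 1 := by simp only [hypB]; linear_combination hypT_sq u
    rw [mDist_of_neg hκ, this]; simp
  exists_mem_geodSeg := exists_mem_geodSeg_klein hκ

lemma exists_isProjectiveModel {κ : ℝ} (hκ : κ ≤ 0) : ∃ k, IsProjectiveModel κ k := by
  rcases hκ.lt_or_eq with h | rfl
  · exact ⟨_, isProjectiveModel_klein h⟩
  · exact ⟨_, isProjectiveModel_id⟩

end

section

variable {X : Type*} [MetricSpace X]

/-- `φ`, with inverse `ψ`, identifies the closed face `closure G` with a convex subset of the
affine plane, taking geodesics to straight segments. -/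
structure IsFaceChart (G : Set X) (φ : X → ℝ × ℝ) (ψ : ℝ × ℝ → X) : Prop where
  isOpen : IsOpen G
  continuousOn : ContinuousOn φ (closure G)
  leftInvOn : LeftInvOn ψ φ (closure G)
  continuousOn_symm : ContinuousOn ψ (φ '' closure G)
  image_eq : φ '' G = interior (φ '' closure G)
  convex : Convex ℝ (φ '' closure G)
  seg_subset : ∀ x ∈ closure G, ∀ y ∈ closure G, seg x y ⊆ closure G
  image_seg : ∀ x ∈ closure G, ∀ y ∈ closure G, φ '' seg x y = segment ℝ (φ x) (φ y)

theorem PolyComplex2.exists_isFaceChart [Nonempty X] {κ : ℝ} (hκ : κ ≤ 0) (PC : PolyComplex2 κ X)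
    (h : IsCATZero X) {G : Set X} (hG : G ∈ PC.faces) : ∃ φ ψ, IsFaceChart G φ ψ := by
  obtain ⟨k, hk⟩ := exists_isProjectiveModel hκ
  obtain ⟨f, P, ⟨F, hP, -⟩, hinj, hfP, hfG, hdist⟩ := PC.face_chart G hG
  have hPconv : ConvexWrt (mDist κ) P := hP ▸ convexWrt_convexHullWrt _ _
  set φ : X → ℝ × ℝ := k ∘ f with hφ
  have hφinj : InjOn φ (closure G) := fun x hx y hy hxy =>
    hinj hx hy (hk.isOpenEmbedding.injective hxy)
  set ψ := Function.invFunOn φ (closure G)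
  have hleft : LeftInvOn ψ φ (closure G) := hφinj.leftInvOn_invFunOn
  have hφcont : ContinuousOn φ (closure G) := by
    obtain ⟨g, hg, hgk⟩ := hk.exists_modulus
    intro x hx
    rw [ContinuousWithinAt, tendsto_iff_norm_sub_tendsto_zero]
    have h1 : Tendsto (fun y => dist y x) (𝓝[closure G] x) (𝓝 0) := by
      have : Continuous fun y => dist y x := by fun_prop
      simpa using (this.tendsto x).mono_left nhdsWithin_le_nhds
    refine tendsto_of_tendsto_of_tendsto_of_le_of_le' tendsto_const_nhds (hg.comp h1)
      (Eventually.of_forall fun _ => norm_nonneg _) ?_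
    filter_upwards [self_mem_nhdsWithin] with y hy
    rw [Function.comp_apply, ← hdist y hy x hx]
    exact hgk (f y) (f x)
  have hψcont : ContinuousOn ψ (φ '' closure G) := by
    have hfψ : ContinuousOn (f ∘ ψ) (φ '' closure G) := by
      rw [hk.isOpenEmbedding.isInducing.continuousOn_iff]
      refine continuousOn_id.congr ?_
      rintro _ ⟨x, hx, rfl⟩
      simp only [Function.comp, id, hφ]
      exact congrArg φ (hleft hx)
    rintro _ ⟨x, hx, rfl⟩
    rw [ContinuousWithinAt, hleft hx, tendsto_iff_dist_tendsto_zero]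
    have h1 : Tendsto (fun w => mDist κ (f (ψ w)) (f x)) (𝓝[φ '' closure G] φ x) (𝓝 0) := by
      have h2 := hfψ (φ x) (mem_image_of_mem _ hx)
      have h3 := (hk.continuous_mDist.tendsto _).comp
        (h2.prodMk_nhds (tendsto_const_nhds (x := f x)))
      simpa [hk.mDist_self, Function.comp_def, hleft hx] using h3
    refine h1.congr' ?_
    filter_upwards [self_mem_nhdsWithin]
    rintro _ ⟨y, hy, rfl⟩
    rw [hleft hy, hdist y hy x hx]
  have hsegm : ∀ x ∈ closure G, ∀ y ∈ closure G, ∀ w ∈ segment ℝ (φ x) (φ y),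
      ∃ z ∈ closure G, z ∈ seg x y ∧ φ z = w := by
    intro x hx y hy w hw
    obtain ⟨u, hu, rfl⟩ := hk.exists_mem_geodSeg (f x) (f y) w hw
    obtain ⟨z, hz, rfl⟩ : u ∈ f '' closure G :=
      hfP ▸ hPconv _ (hfP ▸ mem_image_of_mem f hx) _ (hfP ▸ mem_image_of_mem f hy) hu
    refine ⟨z, hz, ?_, rfl⟩
    have := add_eq_of_mem_geodSeg hu
    rwa [hdist x hx z hz, hdist z hz y hy, hdist x hx y hy] at this
  have hconv : Convex ℝ (φ '' closure G) := by
    rw [convex_iff_segment_subset]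
    rintro _ ⟨x, hx, rfl⟩ _ ⟨y, hy, rfl⟩ w hw
    obtain ⟨z, hz, -, rfl⟩ := hsegm x hx y hy w hw
    exact mem_image_of_mem _ hz
  have hseg : ∀ x ∈ closure G, ∀ y ∈ closure G, ∀ z ∈ seg x y,
      z ∈ closure G ∧ φ z ∈ segment ℝ (φ x) (φ y) := by
    intro x hx y hy z hz
    have hmem : ∀ t ∈ Icc (0 : ℝ) 1, AffineMap.lineMap (φ x) (φ y) t ∈ segment ℝ (φ x) (φ y) := by
      intro t ht
      rw [segment_eq_image_lineMap]
      exact mem_image_of_mem _ ht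
    have hcont : ContinuousOn (fun t : ℝ => dist x (ψ (AffineMap.lineMap (φ x) (φ y) t)))
        (Icc 0 1) := by
      refine (Continuous.comp_continuousOn (g := fun z => dist x z) (by fun_prop))
        (hψcont.comp (t := φ '' closure G) (by fun_prop) fun t ht => ?_)
      exact hconv.segment_subset (mem_image_of_mem _ hx) (mem_image_of_mem _ hy) (hmem t ht)
    obtain ⟨t, ht, htz⟩ := intermediate_value_Icc zero_le_one hcont
      (show dist x z ∈ _ by
        simp only [AffineMap.lineMap_apply_zero, AffineMap.lineMap_apply_one, hleft hx, hleft hy,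
          dist_self]
        exact ⟨dist_nonneg, dist_le_of_mem_seg hz⟩)
    obtain ⟨z', hz', hz's, hφz'⟩ := hsegm x hx y hy _ (hmem t ht)
    have : z = z' := by
      refine h.eq_of_mem_seg_of_dist_eq hz hz's ?_
      rw [← htz]; beta_reduce; rw [← hφz', hleft hz']
    rw [this, hφz']
    exact ⟨hz', hmem t ht⟩
  refine ⟨φ, ψ, PC.faces_open G hG, hφcont, hleft, hψcont, ?_, hconv,
    fun x hx y hy z hz => (hseg x hx y hy z hz).1, fun x hx y hy => ?_⟩
  · rw [hφ, image_comp, image_comp, hfG, hfP]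
    refine (hk.isOpenEmbedding.isOpenMap.image_interior_subset P).antisymm fun w hw => ?_
    obtain ⟨u, -, rfl⟩ := interior_subset hw
    refine mem_image_of_mem k ?_
    rw [← preimage_image_eq P hk.isOpenEmbedding.injective,
      ← hk.isOpenEmbedding.isOpenMap.preimage_interior_eq_interior_preimage
        hk.isOpenEmbedding.continuous]
    exact hw
  · refine Subset.antisymm ?_ fun w hw => ?_
    · rintro _ ⟨z, hz, rfl⟩
      exact (hseg x hx y hy z hz).2
    · obtain ⟨z, -, hz, rfl⟩ := hsegm x hx y hy w hw
      exact mem_image_of_mem _ hz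

end

section

variable {X : Type*} [MetricSpace X]

namespace IsFaceChart

variable {G : Set X} {φ : X → ℝ × ℝ} {ψ : ℝ × ℝ → X} (hc : IsFaceChart G φ ψ)
include hc

lemma injOn : InjOn φ (closure G) := hc.leftInvOn.injOn

lemma mem_face {x : X} (hx : x ∈ closure G) (h : φ x ∈ interior (φ '' closure G)) : x ∈ G := by
  rw [← hc.image_eq] at h
  obtain ⟨y, hy, hxy⟩ := h
  rwa [← hc.injOn (subset_closure hy) hx hxy]

lemma map_mem {x : X} (hx : x ∈ G) : φ x ∈ interior (φ '' closure G) :=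
  hc.image_eq ▸ mem_image_of_mem φ hx

lemma symm_mem {w : ℝ × ℝ} (hw : w ∈ φ '' closure G) : ψ w ∈ closure G := by
  obtain ⟨x, hx, rfl⟩ := hw
  rwa [hc.leftInvOn hx]

lemma map_symm {w : ℝ × ℝ} (hw : w ∈ φ '' closure G) : φ (ψ w) = w := by
  obtain ⟨x, hx, rfl⟩ := hw
  rw [hc.leftInvOn hx]

lemma symm_mem_face {w : ℝ × ℝ} (hw : w ∈ interior (φ '' closure G)) : ψ w ∈ G :=
  hc.mem_face (hc.symm_mem (interior_subset hw)) (by rwa [hc.map_symm (interior_subset hw)])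

lemma map_mem_segment {x y z : X} (hx : x ∈ closure G) (hy : y ∈ closure G) (hz : z ∈ seg x y) :
    φ z ∈ segment ℝ (φ x) (φ y) :=
  hc.image_seg x hx y hy ▸ mem_image_of_mem φ hz

lemma symm_mem_seg {x y : X} {w : ℝ × ℝ} (hx : x ∈ closure G) (hy : y ∈ closure G)
    (hw : w ∈ segment ℝ (φ x) (φ y)) : ψ w ∈ seg x y := by
  rw [← hc.image_seg x hx y hy] at hw
  obtain ⟨z, hz, rfl⟩ := hw
  rwa [hc.leftInvOn (hc.seg_subset x hx y hy hz)]

lemma mem_face_of_mem_seg {x y z : X} (hx : x ∈ G) (hy : y ∈ closure G) (hz : z ∈ seg x y)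
    (hzy : z ≠ y) : z ∈ G := by
  have hzG := hc.seg_subset x (subset_closure hx) y hy hz
  refine hc.mem_face hzG ?_
  obtain ⟨a, b, ha, hb, hab, h⟩ := hc.map_mem_segment (subset_closure hx) hy hz
  rcases ha.eq_or_lt with h0 | h0
  · refine (hzy (hc.injOn hzG hy ?_)).elim
    rw [← h0, zero_add] at hab
    rw [← h, ← h0, hab, zero_smul, one_smul, zero_add]
  · rw [← h]
    exact hc.convex.combo_interior_self_mem_interior (hc.map_mem hx) (mem_image_of_mem φ hy) h0 hb
      hab

lemma seg_subset_face {x y : X} (hx : x ∈ G) (hy : y ∈ G) : seg x y ⊆ G := by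
  intro z hz
  rcases eq_or_ne z y with rfl | h
  · exact hy
  · exact hc.mem_face_of_mem_seg hx (subset_closure hy) hz h

lemma exists_closedBall_subset {x : X} {W : Set X} (hx : x ∈ G) (hW : W ∈ 𝓝 x) :
    ∃ ρ > 0, closedBall (φ x) ρ ⊆ φ '' (G ∩ W) := by
  obtain ⟨W', hW', hWo, hxW⟩ := _root_.mem_nhds_iff.1 hW
  have ho : IsOpen (interior (φ '' closure G) ∩ ψ ⁻¹' W') :=
    (hc.continuousOn_symm.mono interior_subset).isOpen_inter_preimage isOpen_interior hWo
  have hmem : φ x ∈ interior (φ '' closure G) ∩ ψ ⁻¹' W' :=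
    ⟨hc.map_mem hx, by rwa [mem_preimage, hc.leftInvOn (subset_closure hx)]⟩
  obtain ⟨ρ, hρ, h⟩ := Metric.nhds_basis_closedBall.mem_iff.1 (ho.mem_nhds hmem)
  refine ⟨ρ, hρ, fun w hw => ?_⟩
  obtain ⟨h1, h2⟩ := h hw
  exact ⟨ψ w, ⟨hc.symm_mem_face h1, hW' h2⟩, hc.map_symm (interior_subset h1)⟩

/-- The curve `γ` is nullhomologous off every point of a chart disc avoiding `γ` as soon as it is
so off the centre. -/
lemma nullhomologousIn_of_closedBall {γ : SCC X} {y y' : X} {ρ : ℝ} (hy : y ∈ G) (hy' : y' ∈ G)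
    (hρ : closedBall (φ y) ρ ⊆ φ '' (G ∩ γ.imgᶜ)) (hyy' : dist (φ y') (φ y) < ρ)
    (h : γ.NullhomologousIn {y}ᶜ) : γ.NullhomologousIn {y'}ᶜ := by
  classical
  have hρ0 : 0 < ρ := dist_nonneg.trans_lt hyy'
  set D := closedBall (φ y) ρ
  have hDG : D ⊆ interior (φ '' closure G) := fun w hw => by
    obtain ⟨x, hx, rfl⟩ := hρ hw
    exact hc.map_mem hx.1
  set O : Set X := {x | x ∈ G ∧ dist (φ x) (φ y) < ρ}
  set K : Set X := ψ '' D
  have hK : IsClosed K := ((isCompact_closedBall _ _).image_of_continuousOn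
    (hc.continuousOn_symm.mono (hDG.trans interior_subset))).isClosed
  have hO : IsOpen O := (hc.continuousOn.mono subset_closure).isOpen_inter_preimage hc.isOpen
    (isOpen_ball (x := φ y) (ε := ρ))
  have hOK : O ⊆ K := fun x hx => ⟨φ x, hx.2.le, hc.leftInvOn (subset_closure hx.1)⟩
  have hKG : ∀ x ∈ K, x ∈ G ∧ dist (φ x) (φ y) ≤ ρ := by
    rintro _ ⟨w, hw, rfl⟩
    refine ⟨hc.symm_mem_face (hDG hw), ?_⟩
    rwa [hc.map_symm (interior_subset (hDG hw))]
  set r : ℝ × ℝ → ℝ × ℝ := fun w => φ y + (ρ / ‖w - φ y‖) • (w - φ y)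
  have hr : ∀ w, w ≠ φ y → dist (r w) (φ y) = ρ := by
    intro w hw
    have : 0 < ‖w - φ y‖ := norm_pos_iff.2 (sub_ne_zero.2 hw)
    simp only [r, dist_eq_norm, add_sub_cancel_left, norm_smul, norm_div, norm_norm,
      Real.norm_of_nonneg hρ0.le]
    field_simp
  have hne : ∀ x ∈ K, x ≠ y → φ x ≠ φ y := fun x hx hxy h =>
    hxy (hc.injOn (subset_closure (hKG x hx).1) (subset_closure hy) h)
  set F : X → X := fun x => if x ∈ O then ψ (r (φ x)) else x
  have hsub : γ.img ⊆ {y}ᶜ := by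
    rintro x hx rfl
    obtain ⟨z, hz, hzx⟩ := hρ (mem_closedBall_self hρ0.le)
    exact hz.2 (hc.injOn (subset_closure hz.1) (subset_closure hy) hzx ▸ hx)
  refine h.of_map hsub (f := F) ?_ ?_ ?_
  · refine ContinuousOn.if ?_ ?_ continuousOn_id
    · rintro x ⟨hxy, hx⟩
      have hxK : x ∈ K := hK.closure_subset_iff.2 hOK (frontier_subset_closure hx)
      have hxO : x ∉ O := by
        have : frontier O = closure O \ O := hO.frontier_eq
        exact (this ▸ hx : x ∈ closure O \ O).2
      have hd : ‖φ x - φ y‖ = ρ := by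
        rw [← dist_eq_norm]
        exact le_antisymm (hKG x hxK).2 (not_lt.1 fun hlt => hxO ⟨(hKG x hxK).1, hlt⟩)
      simp only [r, hd, div_self hρ0.ne', one_smul, add_sub_cancel]
      exact hc.leftInvOn (subset_closure (hKG x hxK).1)
    · have hcl : {y}ᶜ ∩ closure {a | a ∈ O} ⊆ {y}ᶜ ∩ K :=
        inter_subset_inter_right _ (hK.closure_subset_iff.2 hOK)
      have hφK : ContinuousOn φ ({y}ᶜ ∩ K) :=
        hc.continuousOn.mono fun x hx => subset_closure (hKG x hx.2).1
      refine ContinuousOn.mono ?_ hcl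
      refine hc.continuousOn_symm.comp (f := fun x => r (φ x)) ?_ fun x hx =>
        interior_subset (hDG (hr _ (hne x hx.2 hx.1)).le)
      have h1 : ContinuousOn (fun x => φ x - φ y) ({y}ᶜ ∩ K) := hφK.sub continuousOn_const
      have h2 : ContinuousOn (fun x => ρ / ‖φ x - φ y‖) ({y}ᶜ ∩ K) :=
        continuousOn_const.div h1.norm fun x hx =>
          norm_ne_zero_iff.2 (sub_ne_zero.2 (hne x hx.2 hx.1))
      exact continuousOn_const.add (h2.smul h1)
  · intro x hx
    simp only [F]
    split_ifs with hxO
    · intro hxy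
      have h1 := hr _ (hne x (hOK hxO) hx)
      have h2 := congrArg φ hxy
      rw [hc.map_symm (interior_subset (hDG h1.le))] at h2
      rw [h2] at h1
      exact hyy'.ne h1
    · rintro rfl
      exact hxO ⟨hy', hyy'⟩
  · intro x hx
    refine if_neg fun hxO => ?_
    obtain ⟨z, hz, hzx⟩ := hρ (mem_closedBall.2 hxO.2.le)
    exact hz.2 (hc.injOn (subset_closure hz.1) (subset_closure hxO.1) hzx ▸ hx)

lemma isPreconnected_inter_ball (h : IsCATZero X) (q : X) (ε : ℝ) :
    IsPreconnected (G ∩ ball q ε) := by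
  refine isPreconnected_of_forall_pair fun x hx y hy => ⟨seg x y, fun z hz =>
    ⟨hc.seg_subset_face hx.1 hy.1 hz, h.seg_subset_ball hx.2 hy.2 hz⟩, left_mem_seg x y,
    right_mem_seg x y, ?_⟩
  have : seg x y = range (h.geo x y) := by
    refine Subset.antisymm (fun z hz => ?_) (range_subset_iff.2 (h.geo_mem_seg x y))
    obtain ⟨t, rfl⟩ := h.exists_eq_geo hz
    exact mem_range_self t
  rw [this]
  exact isPreconnected_range ((h.continuous_geo x).comp (by fun_prop : Continuous fun t => (y, t)))

/-- A face avoiding `γ` near `q` lies, near `q`, either in the interior of `γ` or off it. -/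
lemma subset_interiorSet_or (h : IsCATZero X) {γ : SCC X} {q : X} {ε : ℝ}
    (hγ : Disjoint (ball q ε) γ.img) :
    closure G ∩ ball q ε ⊆ γ.interiorSet ∨ ∀ y ∈ G ∩ ball q ε, γ.NullhomologousIn {y}ᶜ := by
  have hnot : ∀ y ∈ ball q ε, y ∉ γ.img := fun y hy => disjoint_left.1 hγ hy
  set A := {y | y ∈ G ∩ ball q ε ∧ γ.NullhomologousIn {y}ᶜ}
  set B := {y | y ∈ G ∩ ball q ε ∧ ¬ γ.NullhomologousIn {y}ᶜ}
  have hGo : IsOpen (G ∩ ball q ε) := hc.isOpen.inter isOpen_ball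
  have hA : IsOpen A := by
    rw [Metric.isOpen_iff]
    rintro y ⟨hy, hyn⟩
    obtain ⟨r, hr, hb⟩ := hyn.exists_ball (hnot y hy.2)
    obtain ⟨r', hr', hb'⟩ := Metric.isOpen_iff.1 hGo y hy
    exact ⟨min r r', lt_min hr hr', fun z hz => ⟨hb' (ball_subset_ball (min_le_right _ _) hz),
      hb z (ball_subset_ball (min_le_left _ _) hz)⟩⟩
  have hB : IsOpen B := by
    rw [isOpen_iff_mem_nhds]
    rintro y ⟨hy, hyn⟩
    obtain ⟨ρ, hρ, hsub⟩ := hc.exists_closedBall_subset hy.1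
      (Filter.inter_mem (isOpen_ball.mem_nhds hy.2) (γ.isCompact_img.isClosed.isOpen_compl.mem_nhds
        (hnot y hy.2)))
    have ho : IsOpen (G ∩ φ ⁻¹' ball (φ y) (ρ / 3)) :=
      (hc.continuousOn.mono subset_closure).isOpen_inter_preimage hc.isOpen isOpen_ball
    filter_upwards [ho.mem_nhds ⟨hy.1, mem_ball_self (by positivity)⟩, hGo.mem_nhds hy]
      with z hz hz'
    refine ⟨hz', fun hn => hyn ?_⟩
    have hz2 : dist (φ z) (φ y) < ρ / 3 := hz.2
    refine hc.nullhomologousIn_of_closedBall (ρ := ρ / 2) hz.1 hy.1 ?_ ?_ hn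
    · refine (closedBall_subset_closedBall' ?_).trans (hsub.trans (image_mono ?_))
      · linarith
      · exact inter_subset_inter_right _ inter_subset_right
    · rw [dist_comm]; linarith
  by_cases hBe : B.Nonempty
  · left
    have hall : G ∩ ball q ε ⊆ B := by
      refine (hc.isPreconnected_inter_ball h q ε).subset_left_of_subset_union hB hA ?_ ?_ ?_
      · exact disjoint_left.2 fun z hz hz' => hz.2 hz'.2
      · intro z hz
        by_cases hn : γ.NullhomologousIn {z}ᶜ
        · exact Or.inr ⟨hz, hn⟩
        · exact Or.inl ⟨hz, hn⟩
      · obtain ⟨z, hz⟩ := hBe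
        exact ⟨z, hz.1, hz⟩
    rintro x ⟨hxG, hx⟩
    refine ⟨hnot x hx, fun hn => ?_⟩
    obtain ⟨r, hr, hb⟩ := hn.exists_ball (hnot x hx)
    obtain ⟨z, ⟨hz1, hz2⟩, hzG⟩ := mem_closure_iff_nhds.1 hxG _
      (Filter.inter_mem (ball_mem_nhds x hr) (isOpen_ball.mem_nhds hx))
    exact (hall ⟨hzG, hz2⟩).2 (hb z hz1)
  · right
    intro y hy
    by_contra hn
    exact hBe ⟨y, hy, hn⟩

end IsFaceChart

end

section

variable {X : Type*} [MetricSpace X]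

/-! ### Radial truncation -/

namespace IsCATZero

variable (h : IsCATZero X)
include h

/-- The radial retraction onto the closed ball of radius `δ` about `q`. -/
def trunc (q : X) (δ : ℝ) (hδ : 0 < δ) (x : X) : X :=
  h.geo q x ⟨δ / max δ (dist q x), by positivity,
    div_le_one_of_le₀ (le_max_left _ _) (by positivity)⟩

variable {q : X} {δ : ℝ} (hδ : 0 < δ)

lemma continuous_trunc : Continuous (h.trunc q δ hδ) := by
  refine (h.continuous_geo q).comp (continuous_id.prodMk (Continuous.subtype_mk ?_ _))
  exact continuous_const.div (by fun_prop) fun x => (lt_max_of_lt_left hδ).ne'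

lemma trunc_eq_self {x : X} (hx : dist q x ≤ δ) : h.trunc q δ hδ x = x := by
  rw [trunc]
  convert h.geo_one q x using 2
  ext
  simp [max_eq_left hx, hδ.ne']

lemma dist_trunc {x : X} (hx : δ ≤ dist q x) : dist q (h.trunc q δ hδ x) = δ := by
  rw [trunc, h.dist_geo_left]
  have : dist q x ≠ 0 := (hδ.trans_le hx).ne'
  simp only [max_eq_right hx]
  field_simp

lemma dist_trunc_le (x : X) : dist q (h.trunc q δ hδ x) ≤ δ := by
  rcases le_total (dist q x) δ with hx | hx
  · rwa [h.trunc_eq_self hδ hx]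
  · exact (h.dist_trunc hδ hx).le

lemma eq_of_trunc_eq {x y : X} (hy : dist q y < δ) (hxy : h.trunc q δ hδ x = y) : x = y := by
  rcases le_total (dist q x) δ with hx | hx
  · rwa [h.trunc_eq_self hδ hx] at hxy
  · rw [← hxy, h.dist_trunc hδ hx] at hy
    exact (lt_irrefl _ hy).elim

end IsCATZero

/-! ### Sector functions -/

/-- The planar cross product. -/
def cross (u v : ℝ × ℝ) : ℝ := u.1 * v.2 - u.2 * v.1

/-- The planar dot product. -/
def dot (u v : ℝ × ℝ) : ℝ := u.1 * v.1 + u.2 * v.2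

lemma dot_self_pos {v : ℝ × ℝ} (hv : v ≠ 0) : 0 < dot v v := by
  rw [dot]
  by_contra hn
  refine hv (Prod.ext ?_ ?_) <;> simp only [Prod.fst_zero, Prod.snd_zero] <;>
    nlinarith [sq_nonneg v.1, sq_nonneg v.2]

lemma eq_smul_add_smul {v : ℝ × ℝ} (hv : v ≠ 0) (u : ℝ × ℝ) :
    u = (dot v u / dot v v) • v + (cross v u / dot v v) • (-v.2, v.1) := by
  have := (dot_self_pos hv).ne'
  ext <;> simp <;> field_simp <;> simp only [dot, cross] <;> ring

/-- `F` winds once around the point `y` of the face `G` near the boundary point `q`, is constant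
off `G` on the sphere of radius `δ` about `q`, and has the lift `g` on the closed sector cut out
by `G` on this sphere. -/
structure IsSector (h : IsCATZero X) (G : Set X) (q : X) (δ : ℝ) (hδ : 0 < δ) (y : X)
    (F : X → AddCircle (1 : ℝ)) (g : X → ℝ) : Prop where
  mem : y ∈ G
  dist_lt : dist q y < δ
  continuousOn_F : ContinuousOn F {y}ᶜ
  continuousOn_g : ContinuousOn g (closure G ∩ {x | dist q x = δ})
  F_trunc : ∀ x, F (h.trunc q δ hδ x) = F x
  F_eq : ∀ x ∈ closure G, dist q x = δ → F x = g x
  F_eq_zero : ∀ x, dist q x = δ → x ∉ G → F x = 0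
  g_boundary : ∀ x ∈ closure G, dist q x = δ → x ∉ G → g x = 0 ∨ g x = 1
  eq_of_boundary : ∀ x ∈ closure G, ∀ x' ∈ closure G, dist q x = δ → dist q x' = δ →
    (∀ z ∈ seg q x, z ∉ G) → (∀ z ∈ seg q x', z ∉ G) → g x = g x' → x = x'

namespace IsFaceChart

variable {G : Set X} {φ : X → ℝ × ℝ} {ψ : ℝ × ℝ → X} (hc : IsFaceChart G φ ψ)
include hc

/-- Two boundary rays of a face issuing from `q` on the same side of an interior ray agree, once
the second one is not between the interior ray and the first one. -/
lemma not_between {q c x x' : X} (hq : q ∈ closure G) (hcG : c ∈ G) (hx : x ∈ closure G)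
    (hx' : x' ∈ closure G) (hxG : ∀ z ∈ seg q x', z ∉ G) {a b : ℝ} (ha : 0 < a) (hb : 0 < b)
    (h : φ x' - φ q = a • (φ c - φ q) + b • (φ x - φ q)) : False := by
  have hab : 0 < a + b := by positivity
  have he := hc.convex.combo_interior_self_mem_interior (hc.map_mem hcG) (mem_image_of_mem φ hx)
    (div_pos ha hab) (div_pos hb hab).le (by field_simp)
  have hs : 0 < 1 + a + b := by positivity
  have hz := hc.convex.combo_interior_self_mem_interior he (mem_image_of_mem φ hq)
    (div_pos hab hs) (div_pos one_pos hs).le (by field_simp; ring)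
  refine hxG _ (hc.symm_mem_seg hq hx' ?_) (hc.symm_mem_face hz)
  refine ⟨1 - 1 / (1 + a + b), 1 / (1 + a + b), ?_, by positivity, by ring, ?_⟩
  · rw [sub_nonneg, div_le_one hs]; linarith
  · have hx'e : φ x' = φ q + a • (φ c - φ q) + b • (φ x - φ q) := by
      rw [add_assoc, ← h]; abel
    rw [hx'e]
    ext <;> simp <;> field_simp <;> ring

lemma eq_of_same_side (hcat : IsCATZero X) {q c x x' : X} (hq : q ∈ closure G) (hcG : c ∈ G)
    (hx : x ∈ closure G) (hx' : x' ∈ closure G) (hd : dist q x = dist q x')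
    (hxG : ∀ z ∈ seg q x, z ∉ G) (hxG' : ∀ z ∈ seg q x', z ∉ G)
    (hs : 0 < cross (φ c - φ q) (φ x - φ q) * cross (φ c - φ q) (φ x' - φ q)) : x = x' := by
  set v := φ c - φ q
  set u := φ x - φ q with hu
  set u' := φ x' - φ q with hu'
  have h1 : cross v u ≠ 0 := left_ne_zero_of_mul hs.ne'
  have h2 : cross v u' ≠ 0 := right_ne_zero_of_mul hs.ne'
  have hpos : 0 < cross v u' / cross v u := by
    have : cross v u' / cross v u = cross v u * cross v u' / cross v u ^ 2 := by field_simp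
    rw [this]
    positivity
  have hcramer : ∀ w w' : ℝ × ℝ, cross v w ≠ 0 →
      w' = (cross w' w / cross v w) • v + (cross v w' / cross v w) • w := by
    intro w w' hw
    ext <;> simp <;> field_simp <;> simp only [cross] <;> ring
  have hparallel : ∀ z z' : X, z ∈ closure G → z' ∈ closure G → dist q z = dist q z' → ∀ l : ℝ,
      0 ≤ l → l ≤ 1 → φ z' - φ q = l • (φ z - φ q) → z = z' := by
    intro z z' hz hz' hzz' l hl0 hl1 hl
    refine hcat.eq_of_mem_seg_of_dist_eq (right_mem_seg q z) ?_ hzz'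
    rw [← hc.leftInvOn hz']
    refine hc.symm_mem_seg hq hz ⟨1 - l, l, by linarith, hl0, by ring, ?_⟩
    rw [sub_eq_iff_eq_add'.1 hl, sub_smul, smul_sub, one_smul]
    abel
  have e1 := hcramer u u' h1
  have e2 := hcramer u' u h2
  have hanti : cross u u' = -cross u' u := by simp only [cross]; ring
  rcases lt_trichotomy (cross u' u / cross v u) 0 with hk | hk | hk
  · refine (hc.not_between hq hcG hx' hx hxG ?_ ?_ e2).elim
    · have : cross u u' / cross v u' = -(cross u' u / cross v u) / (cross v u' / cross v u) := by
        rw [hanti]; field_simp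
      rw [this]
      exact div_pos (neg_pos.2 hk) hpos
    · rw [← inv_div]; positivity
  · have hk0 : cross u' u = 0 := (div_eq_zero_iff.1 hk).resolve_right h1
    rw [hanti, hk0, neg_zero, zero_div, zero_smul, zero_add] at e2
    rw [hk, zero_smul, zero_add] at e1
    rcases le_total (cross v u' / cross v u) 1 with hl | hl
    · exact hparallel x x' hx hx' hd _ hpos.le hl e1
    · refine (hparallel x' x hx' hx hd.symm _ ?_ ?_ e2).symm
      · rw [← inv_div]; positivity
      · rw [← inv_div]; exact inv_le_one_of_one_le₀ hl
  · exact (hc.not_between hq hcG hx hx' hxG' hk hpos e1).elim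

end IsFaceChart

end

section

variable {X : Type*} [MetricSpace X]

/-- The angular coordinate of a sector with axis coordinate `m` and transversal coordinate `l`. -/
def sectorLift (C m l : ℝ) : ℝ := 1 / 2 + C * l / max m (2 * C * |l|)

lemma sectorLift_of_le {C m l : ℝ} (hC : 0 < C) (hl : l ≠ 0) (hm : m ≤ 2 * C * |l|) :
    sectorLift C m l = if 0 < l then 1 else 0 := by
  rw [sectorLift, max_eq_right hm]
  split_ifs with h
  · rw [abs_of_pos h]; field_simp; norm_num
  · have h' : l < 0 := lt_of_le_of_ne (not_lt.1 h) hl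
    rw [abs_of_neg h']; field_simp; norm_num

lemma coe_sectorLift_of_le {C m l : ℝ} (hC : 0 < C) (hl : l ≠ 0) (hm : m ≤ 2 * C * |l|) :
    (sectorLift C m l : AddCircle (1 : ℝ)) = 0 := by
  rw [sectorLift_of_le hC hl hm]
  split_ifs
  · exact AddCircle.coe_period 1
  · rfl

lemma ContinuousOn.sectorLift {Y : Type*} [TopologicalSpace Y] {s : Set Y} {m l : Y → ℝ} {C : ℝ}
    (hm : ContinuousOn m s) (hl : ContinuousOn l s)
    (h : ∀ x ∈ s, 0 < max (m x) (2 * C * |l x|)) :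
    ContinuousOn (fun x => Cat2Cx.sectorLift C (m x) (l x)) s :=
  continuousOn_const.add ((continuousOn_const.mul hl).div
    (continuous_max.comp_continuousOn (hm.prodMk (continuousOn_const.mul hl.abs)))
    fun x hx => (h x hx).ne')

namespace IsFaceChart

variable {G : Set X} {φ : X → ℝ × ℝ} {ψ : ℝ × ℝ → X} (hc : IsFaceChart G φ ψ)
include hc

/-- On the boundary of the face, the transversal coordinate is bounded away from zero along an
interior segment. -/
lemma exists_le_abs_cross {q c : X} {τ : ℝ} (hq : q ∈ closure G) (hcG : c ∈ G)
    (hv : φ c - φ q ≠ 0) (hτ : 0 < τ) :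
    ∃ ρ > 0, ∀ x ∈ closure G, x ∉ G →
      τ * dot (φ c - φ q) (φ c - φ q) ≤ dot (φ c - φ q) (φ x - φ q) →
      dot (φ c - φ q) (φ x - φ q) ≤ dot (φ c - φ q) (φ c - φ q) →
      ρ ≤ |cross (φ c - φ q) (φ x - φ q)| := by
  set v := φ c - φ q
  have hvv := dot_self_pos hv
  have hK : IsCompact ((fun s : ℝ => φ q + s • v) '' Icc τ 1) :=
    isCompact_Icc.image (by fun_prop)
  have hKsub : (fun s : ℝ => φ q + s • v) '' Icc τ 1 ⊆ interior (φ '' closure G) := by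
    rintro _ ⟨s, hs, rfl⟩
    have := hc.convex.combo_interior_self_mem_interior (hc.map_mem hcG) (mem_image_of_mem φ hq)
      (hτ.trans_le hs.1) (sub_nonneg.2 hs.2) (by ring)
    convert this using 1
    simp only [v, smul_sub, sub_smul, one_smul]
    abel
  obtain ⟨r, hr, hthick⟩ := hK.exists_thickening_subset_open isOpen_interior hKsub
  set w : ℝ × ℝ := (-v.2, v.1)
  refine ⟨r * dot v v / (‖w‖ + 1), by positivity, fun x hx hxG h1 h2 => ?_⟩
  by_contra hlt
  push Not at hlt
  refine hxG (hc.mem_face hx (hthick (mem_thickening_iff.2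
    ⟨_, mem_image_of_mem _ (x := dot v (φ x - φ q) / dot v v) ⟨?_, ?_⟩, ?_⟩)))
  · rwa [le_div_iff₀ hvv]
  · rwa [div_le_one hvv]
  · have he := eq_smul_add_smul hv (φ x - φ q)
    have : φ x - (φ q + (dot v (φ x - φ q) / dot v v) • v) =
        (cross v (φ x - φ q) / dot v v) • w := by
      rw [← sub_sub, sub_eq_iff_eq_add']; exact he
    rw [dist_eq_norm, this, norm_smul, Real.norm_eq_abs, abs_div, abs_of_pos hvv]
    rw [lt_div_iff₀ (by positivity)] at hlt
    rw [div_mul_eq_mul_div, div_lt_iff₀ hvv]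
    nlinarith [norm_nonneg w, abs_nonneg (cross v (φ x - φ q))]

theorem exists_isSector (h : IsCATZero X) {q c : X} (hq : q ∈ closure G) (hqG : q ∉ G)
    (hcG : c ∈ G) : ∃ δ₀ > 0, ∀ δ (hδ : 0 < δ), δ < δ₀ → ∃ y F g, IsSector h G q δ hδ y F g := by
  classical
  have hqc : c ≠ q := fun hqc => hqG (hqc ▸ hcG)
  have hv : φ c - φ q ≠ 0 := sub_ne_zero.2 fun he => hqc (hc.injOn (subset_closure hcG) hq he)
  set v := φ c - φ q with hv_def
  have hvv := dot_self_pos hv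
  set T : X → ℝ := fun x => dot v (φ x - φ q) with hT
  set l : X → ℝ := fun x => cross v (φ x - φ q) with hl
  have hTc : ContinuousOn T (closure G) := by
    have := hc.continuousOn
    simp only [hT, dot]
    fun_prop
  have hlc : ContinuousOn l (closure G) := by
    have := hc.continuousOn
    simp only [hl, cross]
    fun_prop
  have hTq : T q = 0 := by simp [hT, dot]
  obtain ⟨δ₀, hδ₀, hTlt⟩ : ∃ δ₀ > 0, ∀ x ∈ closure G, dist x q < δ₀ → T x < dot v v := by
    have := (hTc q hq).eventually (gt_mem_nhds (by rwa [hTq] : T q < dot v v))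
    obtain ⟨δ₀, hδ₀, hb⟩ := Metric.mem_nhdsWithin_iff.1 this
    exact ⟨δ₀, hδ₀, fun x hx hxd => hb ⟨hxd, hx⟩⟩
  refine ⟨δ₀, hδ₀, fun δ hδ hδδ₀ => ?_⟩
  have haxis : ∀ s ∈ Icc (0 : ℝ) 1, φ q + s • v ∈ segment ℝ (φ q) (φ c) := fun s hs =>
    ⟨1 - s, s, sub_nonneg.2 hs.2, hs.1, by ring, by
      simp only [hv_def, smul_sub, sub_smul, one_smul]; abel⟩
  have haxisQ : ∀ s ∈ Icc (0 : ℝ) 1, φ q + s • v ∈ φ '' closure G := fun s hs =>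
    hc.convex.segment_subset (mem_image_of_mem φ hq) (mem_image_of_mem φ (subset_closure hcG))
      (haxis s hs)
  obtain ⟨τ, hτ0, hτ1, hτd⟩ : ∃ τ : ℝ, 0 < τ ∧ τ < 1 ∧ dist q (ψ (φ q + τ • v)) < δ := by
    have hcont : ContinuousOn (fun s : ℝ => dist q (ψ (φ q + s • v))) (Icc 0 1) := by
      refine (Continuous.comp_continuousOn (g := fun z => dist q z) (by fun_prop)) ?_
      exact hc.continuousOn_symm.comp (f := fun s : ℝ => φ q + s • v) (by fun_prop) haxisQ
    have h00 : (fun s : ℝ => dist q (ψ (φ q + s • v))) 0 < δ := by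
      simpa [hc.leftInvOn hq] using hδ
    have h0 := (hcont 0 ⟨le_rfl, zero_le_one⟩).eventually (gt_mem_nhds h00)
    obtain ⟨r, hr, hb⟩ := Metric.mem_nhdsWithin_iff.1 h0
    refine ⟨min (r / 2) (1 / 2), by positivity, ?_, hb ⟨?_, by positivity, ?_⟩⟩
    · exact (min_le_right _ _).trans_lt (by norm_num)
    · rw [mem_ball, Real.dist_eq, sub_zero, abs_of_pos (by positivity)]
      exact (min_le_left _ _).trans_lt (by linarith)
    · exact (min_le_right _ _).trans (by norm_num)
  have hτI : τ ∈ Icc (0 : ℝ) 1 := ⟨hτ0.le, hτ1.le⟩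
  set y := ψ (φ q + τ • v) with hy
  have hφy : φ y = φ q + τ • v := hc.map_symm (haxisQ τ hτI)
  have hyG : y ∈ G := by
    have hy' : y ∈ seg c q := by
      rw [seg_comm]
      exact hc.symm_mem_seg hq (subset_closure hcG) (haxis τ hτI)
    refine hc.mem_face_of_mem_seg hcG hq hy' fun hyq => ?_
    rw [hyq, left_eq_add, smul_eq_zero] at hφy
    exact hφy.elim hτ0.ne' hv
  obtain ⟨ρ, hρ, hbound⟩ := hc.exists_le_abs_cross hq hcG hv hτ0
  set m : X → ℝ := fun x => T x - τ * dot v v with hm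
  have hmc : ContinuousOn m (closure G) := hTc.sub continuousOn_const
  have hC0 : 0 < (1 - τ) * dot v v / (2 * ρ) := by
    have : 0 < 1 - τ := sub_pos.2 hτ1
    positivity
  set C := (1 - τ) * dot v v / (2 * ρ) with hC
  have hbd : ∀ x ∈ closure G, dist q x ≤ δ → x ∉ G → m x ≤ 2 * C * |l x| := by
    intro x hx hxd hxG
    rcases le_or_gt (m x) 0 with h0 | h0
    · exact h0.trans (by positivity)
    have h1 := hTlt x hx (by rw [dist_comm]; exact hxd.trans_lt hδδ₀)
    have h2 : ρ ≤ |l x| := hbound x hx hxG (sub_pos.1 h0).le h1.le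
    calc m x ≤ (1 - τ) * dot v v := by simp only [hm]; linarith
      _ = 2 * C * ρ := by rw [hC]; field_simp
      _ ≤ 2 * C * |l x| := by gcongr
  have hon_axis : ∀ x ∈ closure G, l x = 0 → φ x = φ q + (T x / dot v v) • v := by
    intro x hx h0
    have he := eq_smul_add_smul hv (φ x - φ q)
    rw [show cross v (φ x - φ q) = 0 from h0, zero_div, zero_smul, add_zero] at he
    exact sub_eq_iff_eq_add'.1 he
  have hy_of : ∀ x ∈ closure G, l x = 0 → m x = 0 → x = y := by
    intro x hx h0 h1
    refine hc.injOn hx (subset_closure hyG) ?_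
    rw [hon_axis x hx h0, hφy, sub_eq_zero.1 h1, mul_div_cancel_right₀ _ hvv.ne']
  have hmax : ∀ x ∈ closure G, dist q x = δ → 0 < max (m x) (2 * C * |l x|) := by
    intro x hx hxd
    by_contra hn
    push Not at hn
    obtain ⟨hn1, hn2⟩ := max_le_iff.1 hn
    have h0 : l x = 0 := by
      rw [← abs_eq_zero]
      nlinarith [abs_nonneg (l x)]
    have hax := hon_axis x hx h0
    have hTle : T x / dot v v ≤ τ := by rw [div_le_iff₀ hvv]; simpa [hm] using hn1
    set s := T x / dot v v
    rcases le_or_gt 0 s with hs | hs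
    · have hmem : ψ (φ x) ∈ seg q y := by
        refine hc.symm_mem_seg hq (subset_closure hyG) ⟨1 - s / τ, s / τ, ?_, by positivity,
          by ring, ?_⟩
        · rw [sub_nonneg, div_le_one hτ0]; exact hTle
        · rw [hφy, hax, smul_add, smul_smul, div_mul_cancel₀ _ hτ0.ne', sub_smul, one_smul]
          abel
      rw [hc.leftInvOn hx] at hmem
      have := dist_le_of_mem_seg hmem
      linarith
    · refine hqG (hc.mem_face hq ?_)
      have h1s : 0 < 1 - s := by linarith
      have := hc.convex.combo_interior_self_mem_interior (hc.map_mem hcG) (mem_image_of_mem φ hx)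
        (div_pos (neg_pos.2 hs) h1s) (div_pos one_pos h1s).le (by field_simp; ring)
      convert this using 1
      rw [hax, show φ c = φ q + v by simp [hv_def]]
      ext <;> simp <;> field_simp <;> ring
  have hne : ∀ x ∈ closure G, dist q x = δ → m x ≤ 2 * C * |l x| → l x ≠ 0 := by
    intro x hx hxd hle h0
    have := hmax x hx hxd
    rw [max_eq_right hle, h0] at this
    simp at this
  set O : Set X := {x | x ∈ G ∧ 2 * C * |l x| < m x} with hO
  set f : X → AddCircle (1 : ℝ) := fun x => if x ∈ O then (sectorLift C (m x) (l x) : ℝ) else 0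
  have hOcl : closure O ⊆ closure G := closure_mono fun x hx => hx.1
  have hOo : IsOpen O := by
    have h1 : ContinuousOn (fun x => m x - 2 * C * |l x|) G :=
      (hmc.sub (continuousOn_const.mul hlc.abs)).mono subset_closure
    convert h1.isOpen_inter_preimage hc.isOpen (isOpen_Ioi (a := (0 : ℝ))) using 1
    ext x
    simp [hO]
  have hle_cl : ∀ x ∈ closure O, 2 * C * |l x| ≤ m x := by
    intro x hx
    have h1 : ContinuousWithinAt (fun x => 2 * C * |l x|) O x :=
      ((continuousOn_const.mul hlc.abs) x (hOcl hx)).mono fun z hz => subset_closure hz.1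
    have h2 : ContinuousWithinAt m O x := (hmc x (hOcl hx)).mono fun z hz => subset_closure hz.1
    have : (𝓝[O] x).NeBot := mem_closure_iff_nhdsWithin_neBot.1 hx
    exact le_of_tendsto_of_tendsto h1 h2 (eventually_nhdsWithin_of_forall fun z hz => hz.2.le)
  have hm_pos : ∀ x ∈ closure O, x ≠ y → 0 < m x := by
    intro x hx hxy
    have h1 := hle_cl x hx
    have h2 : 0 ≤ 2 * C * |l x| := by positivity
    refine lt_of_le_of_ne (h2.trans h1) fun h0 => hxy (hy_of x (hOcl hx) ?_ h0.symm)
    rw [← abs_eq_zero]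
    rw [← h0] at h1
    nlinarith [abs_nonneg (l x)]
  have hf : ContinuousOn f ({y}ᶜ ∩ {x | dist q x ≤ δ}) := by
    refine ContinuousOn.if ?_ ?_ continuousOn_const
    · rintro x ⟨⟨hxy, hxd⟩, hx⟩
      have hxcl : x ∈ closure O := frontier_subset_closure hx
      have hxO : x ∉ O := by
        have : frontier O = closure O \ O := hOo.frontier_eq
        exact (this ▸ hx : x ∈ closure O \ O).2
      have hle : m x ≤ 2 * C * |l x| := by
        by_cases hxG : x ∈ G
        · exact not_lt.1 fun hlt => hxO ⟨hxG, hlt⟩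
        · exact hbd x (hOcl hxcl) hxd hxG
      refine coe_sectorLift_of_le hC0 (fun h0 => ?_) hle
      have := (hm_pos x hxcl hxy).trans_le hle
      rw [h0] at this
      simp at this
    · refine Continuous.comp_continuousOn (g := fun s : ℝ => (s : AddCircle (1 : ℝ)))
        (AddCircle.continuous_mk' 1) (ContinuousOn.sectorLift ?_ ?_ ?_)
      · exact hmc.mono fun x hx => hOcl hx.2
      · exact hlc.mono fun x hx => hOcl hx.2
      · exact fun x hx => lt_max_of_lt_left (hm_pos x hx.2 hx.1.1)
  have hf_eq : ∀ x ∈ closure G, dist q x = δ → f x = (sectorLift C (m x) (l x) : ℝ) := by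
    intro x hx hxd
    simp only [f]
    split_ifs with hxO
    · rfl
    · have hle : m x ≤ 2 * C * |l x| := by
        by_cases hxG : x ∈ G
        · exact not_lt.1 fun hlt => hxO ⟨hxG, hlt⟩
        · exact hbd x hx hxd.le hxG
      exact (coe_sectorLift_of_le hC0 (hne x hx hxd hle) hle).symm
  refine ⟨y, fun x => f (h.trunc q δ hδ x), fun x => sectorLift C (m x) (l x), hyG, hτd, ?_, ?_,
    fun x => ?_, fun x hx hxd => ?_, fun x hxd hxG => ?_, fun x hx hxd hxG => ?_,
    fun x hx x' hx' hxd hxd' hs hs' hxx' => ?_⟩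
  · refine hf.comp (h.continuous_trunc hδ).continuousOn fun x hx => ⟨fun hxy => ?_, ?_⟩
    · exact hx (h.eq_of_trunc_eq hδ hτd hxy)
    · exact h.dist_trunc_le hδ x
  · exact ContinuousOn.sectorLift (hmc.mono inter_subset_left) (hlc.mono inter_subset_left)
      fun x hx => hmax x hx.1 hx.2
  · rw [h.trunc_eq_self hδ (h.dist_trunc_le hδ x)]
  · rw [h.trunc_eq_self hδ hxd.le, hf_eq x hx hxd]
  · rw [h.trunc_eq_self hδ hxd.le]
    exact if_neg fun hxO => hxG hxO.1
  · have hle := hbd x hx hxd.le hxG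
    rw [sectorLift_of_le hC0 (hne x hx hxd hle) hle]
    split_ifs <;> simp
  · have hxG := hs x (right_mem_seg q x)
    have hxG' := hs' x' (right_mem_seg q x')
    have hle := hbd x hx hxd.le hxG
    have hle' := hbd x' hx' hxd'.le hxG'
    have h0 := hne x hx hxd hle
    have h0' := hne x' hx' hxd' hle'
    rw [sectorLift_of_le hC0 h0 hle, sectorLift_of_le hC0 h0' hle'] at hxx'
    refine hc.eq_of_same_side h hq hcG hx hx' (hxd.trans hxd'.symm) hs hs' ?_
    change 0 < l x * l x'
    split_ifs at hxx' with h1 h2 h2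
    · exact mul_pos h1 h2
    · norm_num at hxx'
    · norm_num at hxx'
    · exact mul_pos_of_neg_of_neg (lt_of_le_of_ne (not_lt.1 h1) h0)
        (lt_of_le_of_ne (not_lt.1 h2) h0')

end IsFaceChart

end

section

/-! ### Potentials along a curve in a sphere -/

lemma eq_of_coe_eq_of_abs_sub_lt {a b : ℝ} (h : (a : AddCircle (1 : ℝ)) = (b : AddCircle (1 : ℝ)))
    (hlt : |a - b| < 1) : a = b := by
  rw [← sub_eq_zero, ← AddCircle.coe_sub, AddCircle.coe_eq_zero_iff] at h
  obtain ⟨n, hn⟩ := h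
  rw [zsmul_eq_mul, mul_one] at hn
  rw [← hn, ← Int.cast_abs, ← Int.cast_one, Int.cast_lt, Int.abs_lt_one_iff] at hlt
  rw [hlt, Int.cast_zero] at hn
  linarith

variable {X : Type*} [MetricSpace X] {A : Type*} [AddCommGroup A]

/-- The increment of a potential along a loop in a small sphere is determined by the winding of
the loop around the sectors of the sphere. -/
lemma sub_eq_sum_floor_smul {hX : IsCATZero X} {q : X} {δ : ℝ} {hδ : 0 < δ} {𝓕 : Finset (Set X)}
    {c : unitInterval → X} (hc : Continuous c) (hcS : ∀ t, dist q (c t) = δ) (hloop : c 0 = c 1)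
    (hopen : ∀ G ∈ 𝓕, IsOpen G) (hdisj : ∀ G ∈ 𝓕, ∀ G' ∈ 𝓕, G ≠ G' → Disjoint G G')
    (hE : {x | dist q x = δ ∧ ∀ G ∈ 𝓕, x ∉ G}.Finite)
    {y : Set X → X} {F : Set X → X → AddCircle (1 : ℝ)} {g : Set X → X → ℝ}
    (hsec : ∀ G ∈ 𝓕, IsSector hX G q δ hδ (y G) (F G) (g G))
    {θ : Set X → unitInterval → ℝ} (hθ : ∀ G ∈ 𝓕, Continuous (θ G))
    (hθF : ∀ G ∈ 𝓕, ∀ t, (θ G t : AddCircle (1 : ℝ)) = F G (c t))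
    {P : unitInterval → A} {pot : Set X → X → A} {u : X → A} {a : Set X → A}
    (hP : ∀ t₀, ∀ᶠ t in 𝓝 t₀, (c t = c t₀ → P t = P t₀) ∧
      ∀ G ∈ 𝓕, c t ∈ closure G → c t₀ ∈ closure G → P t - P t₀ = pot G (c t) - pot G (c t₀))
    (hu : ∀ G ∈ 𝓕, ∀ x ∈ closure G, x ∉ G → dist q x = δ → u x = pot G x - ⌊g G x⌋ • a G) :
    P 1 - P 0 = ∑ G ∈ 𝓕, (⌊θ G 1⌋ - ⌊θ G 0⌋) • a G := by
  classical
  have hdisj_cl : ∀ G ∈ 𝓕, ∀ G' ∈ 𝓕, G' ≠ G → ∀ x ∈ closure G, x ∉ G' := fun G hG G' hG' hne x hx =>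
    ((hdisj G' hG' G hG hne).closure_right (hopen G' hG')).notMem_of_mem_right hx
  let w : X → A := fun x =>
    if hx : ∃ G ∈ 𝓕, x ∈ G then pot hx.choose x - ⌊g hx.choose x⌋ • a hx.choose else u x
  have hw : ∀ G ∈ 𝓕, ∀ x ∈ closure G, dist q x = δ → w x = pot G x - ⌊g G x⌋ • a G := by
    intro G hG x hx hxd
    by_cases hxG : ∃ G ∈ 𝓕, x ∈ G
    · have : hxG.choose = G := by
        by_contra hne
        exact hdisj_cl G hG _ hxG.choose_spec.1 hne x hx hxG.choose_spec.2
      simp only [w, dif_pos hxG, this]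
    · simp only [w, dif_neg hxG]
      exact hu G hG x hx (fun h => hxG ⟨G, hG, h⟩) hxd
  have hθeq : ∀ t₀, ∀ᶠ t in 𝓝 t₀, ∀ G ∈ 𝓕, c t ∉ G → c t₀ ∉ G → θ G t = θ G t₀ := by
    intro t₀
    rw [eventually_all_finset]
    intro G hG
    filter_upwards [(hθ G hG).continuousAt.eventually (ball_mem_nhds (θ G t₀) one_pos)]
      with t ht h1 h2
    refine eq_of_coe_eq_of_abs_sub_lt ?_ ht
    rw [hθF G hG, hθF G hG, (hsec G hG).F_eq_zero _ (hcS t) h1, (hsec G hG).F_eq_zero _ (hcS t₀) h2]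
  have hfloor : ∀ t₀, ∀ᶠ t in 𝓝 t₀, ∀ G ∈ 𝓕, c t ∈ closure G → c t₀ ∈ closure G →
      ⌊θ G t⌋ - ⌊θ G t₀⌋ = ⌊g G (c t)⌋ - ⌊g G (c t₀)⌋ := by
    intro t₀
    rw [eventually_all_finset]
    intro G hG
    by_cases hx : c t₀ ∈ closure G
    swap
    · exact Eventually.of_forall fun t _ h => (hx h).elim
    have hg : ∀ᶠ t in 𝓝 t₀, c t ∈ closure G → g G (c t) ∈ ball (g G (c t₀)) (1 / 2) := by
      have h1 := ((hsec G hG).continuousOn_g (c t₀) ⟨hx, hcS t₀⟩).eventually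
        (ball_mem_nhds (g G (c t₀)) (by norm_num : (0 : ℝ) < 1 / 2))
      rw [eventually_nhdsWithin_iff] at h1
      exact (hc.continuousAt.eventually h1).mono fun t ht h => ht ⟨h, hcS t⟩
    filter_upwards [hg, (hθ G hG).continuousAt.eventually
      (ball_mem_nhds (θ G t₀) (by norm_num : (0 : ℝ) < 1 / 2))] with t h1 h2 h3 h4
    have h1 := h1 h3
    rw [mem_ball, Real.dist_eq] at h1
    rw [Real.dist_eq] at h2
    have key : ∀ s, c s ∈ closure G → ((θ G s : ℝ) : AddCircle (1 : ℝ)) = (g G (c s) : ℝ) :=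
      fun s hs => by rw [hθF G hG, (hsec G hG).F_eq _ hs (hcS s)]
    have h5 : θ G t - g G (c t) = θ G t₀ - g G (c t₀) := by
      refine eq_of_coe_eq_of_abs_sub_lt ?_ ?_
      · rw [AddCircle.coe_sub, AddCircle.coe_sub, key t h3, key t₀ h4, sub_self, sub_self]
      · calc _ = |(θ G t - θ G t₀) - (g G (c t) - g G (c t₀))| := by congr 1; ring
          _ ≤ _ := abs_sub _ _
          _ < 1 := by linarith
    obtain ⟨n, hn⟩ : ∃ n : ℤ, (n : ℝ) = θ G t₀ - g G (c t₀) := by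
      have h6 := key t₀ h4
      rw [← sub_eq_zero, ← AddCircle.coe_sub, AddCircle.coe_eq_zero_iff] at h6
      obtain ⟨n, hn⟩ := h6
      exact ⟨n, by simpa using hn⟩
    rw [show θ G t = g G (c t) + n by rw [hn, ← h5]; ring,
      show θ G t₀ = g G (c t₀) + n by rw [hn]; ring, Int.floor_add_intCast, Int.floor_add_intCast]
    ring
  have hclos : ∀ t₀, ∀ᶠ t in 𝓝 t₀, ∀ G ∈ 𝓕, c t ∈ closure G → c t₀ ∈ closure G := by
    intro t₀
    rw [eventually_all_finset]
    intro G hG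
    by_cases hx : c t₀ ∈ closure G
    · exact Eventually.of_forall fun _ _ => hx
    · exact (hc.continuousAt.eventually (isClosed_closure.isOpen_compl.mem_nhds hx)).mono
        fun t ht h => (ht h).elim
  have hEx : ∀ t₀, ∀ᶠ t in 𝓝 t₀, (∀ G ∈ 𝓕, c t ∉ G) → c t = c t₀ := by
    intro t₀
    have h1 := (hE.subset (sdiff_subset (t := {c t₀}))).isClosed.isOpen_compl.mem_nhds
      (show c t₀ ∈ _ from fun h => h.2 rfl)
    refine (hc.continuousAt.eventually h1).mono fun t ht h => ?_
    by_contra hne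
    exact ht ⟨⟨hcS t, h⟩, hne⟩
  let D : unitInterval → A := fun t => P t - w (c t) - ∑ G ∈ 𝓕, ⌊θ G t⌋ • a G
  have hD : IsLocallyConstant D := by
    rw [IsLocallyConstant.iff_eventually_eq]
    intro t₀
    filter_upwards [hP t₀, hθeq t₀, hfloor t₀, hclos t₀, hEx t₀] with t h1 h2 h3 h4 h5
    by_cases hG : ∃ G ∈ 𝓕, c t ∈ G
    · obtain ⟨G, hG, ht⟩ := hG
      have ht' := subset_closure ht
      have ht₀ := h4 G hG ht'
      have hsum : ∑ G ∈ 𝓕, ⌊θ G t⌋ • a G - ∑ G ∈ 𝓕, ⌊θ G t₀⌋ • a G =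
          (⌊g G (c t)⌋ - ⌊g G (c t₀)⌋) • a G := by
        rw [← Finset.sum_sub_distrib, Finset.sum_eq_single_of_mem G hG, ← sub_smul,
          h3 G hG ht' ht₀]
        intro G' hG' hne
        rw [h2 G' hG' (hdisj_cl G hG G' hG' hne _ ht') (hdisj_cl G hG G' hG' hne _ ht₀), sub_self]
      have hPt := h1.2 G hG ht' ht₀
      rw [← sub_eq_zero]
      simp only [D]
      rw [hw G hG _ ht' (hcS t), hw G hG _ ht₀ (hcS t₀)]
      rw [sub_smul] at hsum
      calc _ = (P t - P t₀) - (pot G (c t) - pot G (c t₀)) +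
            (⌊g G (c t)⌋ • a G - ⌊g G (c t₀)⌋ • a G)
            - (∑ G ∈ 𝓕, ⌊θ G t⌋ • a G - ∑ G ∈ 𝓕, ⌊θ G t₀⌋ • a G) := by abel
        _ = 0 := by rw [hPt, hsum]; abel
    · push Not at hG
      have hx := h5 hG
      simp only [D]
      rw [h1.1 hx, hx, Finset.sum_congr rfl fun G' hG' => ?_]
      rw [h2 G' hG' (hG G' hG') (hx ▸ hG G' hG')]
  have h01 := hD.apply_eq_of_isPreconnected isPreconnected_univ (mem_univ 1) (mem_univ 0)
  simp only [D, hloop, sub_smul, Finset.sum_sub_distrib] at h01 ⊢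
  rw [← sub_eq_zero] at h01 ⊢
  rw [← h01]
  abel

end

section

variable {X : Type*} [MetricSpace X] {κ : ℝ}

/-! ### Local structure of a polyhedral complex -/

namespace PolyComplex2

variable (PC : PolyComplex2 κ X)
include PC

lemma exists_closure_edge_eq {e : Set X} (he : e ∈ PC.edges) :
    ∃ (f : ℝ → X) (L : ℝ), (∀ s ∈ Icc 0 L, ∀ t ∈ Icc 0 L, dist (f s) (f t) = |s - t|) ∧
      closure e = f '' Icc 0 L := by
  obtain ⟨f, L, hL, ⟨-, hf⟩, rfl⟩ := PC.edge_geodesic e he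
  have hfc : ContinuousOn f (Icc 0 L) := by
    refine LipschitzOnWith.continuousOn (K := 1) (LipschitzOnWith.of_dist_le_mul ?_)
    intro s hs t ht
    rw [NNReal.coe_one, one_mul]
    exact (hf s hs t ht).le
  refine ⟨f, L, hf, Subset.antisymm ?_ ?_⟩
  · exact closure_minimal (image_mono Ioo_subset_Icc_self)
      (isCompact_Icc.image_of_continuousOn hfc).isClosed
  · rw [← closure_Ioo hL.ne] at hfc ⊢
    exact hfc.image_closure

lemma notMem_face_of_mem_closure_edge {e G : Set X} (he : e ∈ PC.edges) (hG : G ∈ PC.faces)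
    (heG : e ∉ PC.faces) {x : X} (hx : x ∈ closure e) : x ∉ G := by
  intro hxG
  by_cases hxe : x ∈ e
  · have : x ∈ e ∩ G := ⟨hxe, hxG⟩
    rw [PC.cells_disjoint e (Or.inr he) G (Or.inl hG) (fun h => heG (h ▸ hG))] at this
    exact this
  · have : x ∈ G ∩ PC.vertices := ⟨hxG, PC.edge_closure e he ⟨hx, hxe⟩⟩
    rw [PC.cells_vertex_disjoint G (Or.inl hG)] at this
    exact this

lemma seg_subset_closure_edge (h : IsCATZero X) {e : Set X} (he : e ∈ PC.edges) {x y : X}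
    (hx : x ∈ closure e) (hy : y ∈ closure e) : seg x y ⊆ closure e := by
  obtain ⟨f, L, hf, hfe⟩ := PC.exists_closure_edge_eq he
  rw [hfe] at hx hy ⊢
  obtain ⟨s, hs, rfl⟩ := hx
  obtain ⟨t, ht, rfl⟩ := hy
  wlog hst : s ≤ t generalizing s t
  · rw [seg_comm]
    exact this t ht s hs (le_of_not_ge hst)
  intro z hz
  have hle := dist_le_of_mem_seg hz
  rw [hf s hs t ht, abs_sub_comm, abs_of_nonneg (sub_nonneg.2 hst)] at hle
  have hd := dist_nonneg (x := f s) (y := z)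
  have hr : s + dist (f s) z ∈ Icc 0 L := ⟨by linarith [hs.1], by linarith [ht.2]⟩
  have h1 : dist (f s) (f (s + dist (f s) z)) = dist (f s) z := by
    rw [hf s hs _ hr, sub_add_cancel_left, abs_neg, abs_of_nonneg hd]
  refine ⟨_, hr, h.eq_of_mem_seg_of_dist_eq ?_ hz h1⟩
  rw [seg, mem_ofPred_eq, h1, hf _ hr t ht, hf s hs t ht, abs_sub_comm, abs_sub_comm s,
    abs_of_nonneg (by linarith), abs_of_nonneg (by linarith)]
  ring

lemma finite_closure_edge_inter_sphere {e : Set X} (he : e ∈ PC.edges) {q : X}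
    (hq : q ∈ closure e) (δ : ℝ) : (closure e ∩ {x | dist q x = δ}).Finite := by
  obtain ⟨f, L, hf, hfe⟩ := PC.exists_closure_edge_eq he
  rw [hfe] at hq ⊢
  obtain ⟨s, hs, rfl⟩ := hq
  refine (Set.toFinite {f (s - δ), f (s + δ)}).subset ?_
  rintro _ ⟨⟨t, ht, rfl⟩, hd⟩
  rw [mem_ofPred_eq, hf s hs t ht] at hd
  rcases abs_choice (s - t) with h | h
  · exact Or.inl (congrArg f (by linarith))
  · exact Or.inr (congrArg f (by linarith))

/-- Small balls about `q` meet only finitely many cells, all of them adjacent to `q`. -/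
lemma exists_conical_ball {K : Set X} (hK : IsClosed K) {q : X} (hq : q ∉ K) :
    ∃ ε > 0, Disjoint (ball q ε) K ∧
      {c | (c ∈ PC.faces ∨ c ∈ PC.edges) ∧ (c ∩ ball q ε).Nonempty}.Finite ∧
      (∀ c, (c ∈ PC.faces ∨ c ∈ PC.edges) → (c ∩ ball q ε).Nonempty → q ∈ closure c) ∧
      PC.vertices ∩ ball q ε ⊆ {q} := by
  obtain ⟨ε₀, hε₀, hfin, hvfin⟩ := PC.locally_finite q
  have h1 : ∀ᶠ x in 𝓝 q, x ∉ K := hK.isOpen_compl.mem_nhds hq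
  have h2 : ∀ᶠ x in 𝓝 q, ∀ c ∈ {c | (c ∈ PC.faces ∨ c ∈ PC.edges) ∧ (c ∩ ball q ε₀).Nonempty},
      x ∈ closure c → q ∈ closure c := by
    rw [eventually_all_finite hfin]
    intro c hc
    by_cases hqc : q ∈ closure c
    · exact Eventually.of_forall fun _ _ => hqc
    · exact (isClosed_closure.isOpen_compl.eventually_mem hqc).mono fun x hx h => (hx h).elim
  have h3 : ∀ᶠ x in 𝓝 q, x ∉ (PC.vertices ∩ ball q ε₀) \ {q} :=
    (hvfin.subset sdiff_subset).isClosed.isOpen_compl.mem_nhds fun h => h.2 rfl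
  obtain ⟨r, hr, hb⟩ := Metric.mem_nhds_iff.1 (h1.and (h2.and h3))
  have hsub : ball q (min r ε₀) ⊆ ball q ε₀ := ball_subset_ball (min_le_right _ _)
  have hbr : ∀ x ∈ ball q (min r ε₀), _ := fun x hx => hb (ball_subset_ball (min_le_left _ _) hx)
  refine ⟨min r ε₀, lt_min hr hε₀, ?_, ?_, ?_, ?_⟩
  · exact Set.disjoint_left.2 fun x hx => (hbr x hx).1
  · exact hfin.subset fun c hc => ⟨hc.1, hc.2.mono (inter_subset_inter_right _ hsub)⟩
  · rintro c hc ⟨x, hxc, hx⟩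
    exact (hbr x hx).2.1 c ⟨hc, x, hxc, hsub hx⟩ (subset_closure hxc)
  · rintro x ⟨hxv, hx⟩
    by_contra hne
    exact (hbr x hx).2.2 ⟨⟨hxv, hsub hx⟩, hne⟩

/-- A point of a small ball about `q` outside the faces lies on an edge adjacent to `q`. -/
lemma exists_edge_of_notMem_face {q x : X} {ε : ℝ}
    (hcl : ∀ c, (c ∈ PC.faces ∨ c ∈ PC.edges) → (c ∩ ball q ε).Nonempty → q ∈ closure c)
    (hv : PC.vertices ∩ ball q ε ⊆ {q}) (hx : x ∈ ball q ε) (hxq : x ≠ q)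
    (hxG : ∀ G ∈ PC.faces, x ∉ G) :
    ∃ e ∈ PC.edges, e ∉ PC.faces ∧ x ∈ e ∧ q ∈ closure e := by
  have hcov : x ∈ ⋃₀ PC.faces ∪ ⋃₀ PC.edges ∪ PC.vertices := PC.cover ▸ mem_univ x
  rcases hcov with (⟨G, hG, hxG'⟩ | ⟨e, he, hxe⟩) | hxv
  · exact (hxG G hG hxG').elim
  · exact ⟨e, he, fun he' => hxG e he' hxe, hxe, hcl e (Or.inr he) ⟨x, hxe, hx⟩⟩
  · exact (hxq (hv ⟨hxv, hx⟩)).elim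

end PolyComplex2

end

section

variable {X : Type*} [MetricSpace X] {A : Type*} [AddCommGroup A]

/-! ### Potentials of path cocycles -/

/-- The function `g` is a potential of the path cocycle `Φ` on the set `S`. -/
def IsPotential {B : Set X} (Φ : PathCocycle B A) (S : Set X) (g : X → A) : Prop :=
  ∀ (x y : B) (p : Path x y), (∀ t, (p t : X) ∈ S) → Φ.toFun p = g y - g x

lemma exists_isPotential {B S : Set X} (Φ : PathCocycle B A) (hSB : S ⊆ B)
    (hS : ContractibleSpace S) : ∃ g, IsPotential Φ S g := by
  classical
  obtain ⟨g, hg⟩ := (Φ.comap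
    (⟨inclusion hSB, continuous_inclusion hSB⟩ : C(S, B))).exists_potential_univ
  refine ⟨fun y => if h : y ∈ S then g ⟨y, h⟩ else 0, fun x y p hp => ?_⟩
  have hx : (x : X) ∈ S := by simpa using hp 0
  have hy : (y : X) ∈ S := by simpa using hp 1
  simp only [dif_pos hx, dif_pos hy]
  rw [← hg ⟨x, hx⟩ ⟨y, hy⟩ ⟨⟨fun t => ⟨p t, hp t⟩, by fun_prop⟩, by simp, by simp⟩]
  exact Φ.map_congr _ _ fun t => rfl

lemma IsPotential.sub_const {B S : Set X} {Φ : PathCocycle B A} {g : X → A}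
    (hg : IsPotential Φ S g) (a : A) : IsPotential Φ S fun x => g x - a := fun x y p hp => by
  rw [hg x y p hp, sub_sub_sub_cancel_right]

namespace IsCATZero

variable (h : IsCATZero X)
include h

lemma exists_path_mem_seg {B : Set X} {x y : B} (hxy : seg (x : X) y ⊆ B) :
    ∃ p : Path x y, ∀ t, (p t : X) ∈ seg (x : X) y :=
  ⟨⟨⟨fun t => ⟨h.geo x y t, hxy (h.geo_mem_seg _ _ _)⟩,
      ((h.continuous_geo (x : X)).comp
        (by fun_prop : Continuous fun t => ((y : X), t))).subtype_mk _⟩,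
    Subtype.ext (h.geo_zero _ _), Subtype.ext (h.geo_one _ _)⟩, fun t => h.geo_mem_seg _ _ _⟩

lemma potential_sub_eq {B S S' : Set X} {Φ : PathCocycle B A} {g g' : X → A}
    (hg : IsPotential Φ S g) (hg' : IsPotential Φ S' g') {x y : X} (hB : seg x y ⊆ B)
    (hS : seg x y ⊆ S) (hS' : seg x y ⊆ S') : g y - g x = g' y - g' x := by
  obtain ⟨p, hp⟩ := h.exists_path_mem_seg (B := B) (x := ⟨x, hB (left_mem_seg x y)⟩)
    (y := ⟨y, hB (right_mem_seg x y)⟩) hB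
  rw [← hg _ _ p fun t => hS (hp t), ← hg' _ _ p fun t => hS' (hp t)]

/-- A path cocycle on the complement of a point has a primitive along every curve, which is locally
given by potentials. -/
lemma exists_primitive {q : X} (Φ : PathCocycle ({q}ᶜ : Set X) A)
    {b : ({q}ᶜ : Set X)} (c : Path b b) :
    ∃ P : unitInterval → A, Φ.toFun c = P 1 - P 0 ∧ ∀ t₀, ∀ᶠ t in 𝓝 t₀, (c t = c t₀ → P t = P t₀) ∧
      ∀ S g, IsPotential Φ S g → seg (c t₀ : X) (c t) ⊆ S →
        P t - P t₀ = g (c t) - g (c t₀) := by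
  have : ContractibleSpace unitInterval :=
    (convex_Icc (0 : ℝ) 1).contractibleSpace (nonempty_Icc.2 zero_le_one)
  have : LocallyPathConnectedSpace unitInterval := (convex_Icc (0 : ℝ) 1).locallyPathConnectedSpace
  obtain ⟨P, hP⟩ := (Φ.comap c.toContinuousMap).exists_potential_univ
  refine ⟨P, ?_, fun t₀ => ?_⟩
  · rw [← hP 0 1 ⟨ContinuousMap.id _, rfl, rfl⟩]
    exact Φ.map_congr _ _ fun t => rfl
  have hne : (c t₀ : X) ≠ q := (c t₀).2
  have hr : 0 < dist q (c t₀ : X) := dist_pos.2 hne.symm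
  have hball : ball (c t₀ : X) (dist q (c t₀ : X)) ⊆ {q}ᶜ := by
    rintro z hz rfl
    exact lt_irrefl _ (mem_ball.1 hz)
  obtain ⟨u, hu⟩ := exists_isPotential Φ hball (h.contractibleSpace_of_seg_subset (mem_ball_self hr)
    fun x hx => h.seg_subset_ball (mem_ball_self hr) hx)
  have hcont : Continuous fun t => (c t : X) := by fun_prop
  have hnhds := hcont.continuousAt.preimage_mem_nhds (ball_mem_nhds (c t₀ : X) hr)
  obtain ⟨V, ⟨hV, hVc⟩, hVsub⟩ := (path_connected_basis t₀).mem_iff.1 hnhds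
  filter_upwards [hV] with t ht
  have hinc : P t - P t₀ = u (c t) - u (c t₀) := by
    obtain ⟨w, hw⟩ := hVc.joinedIn t₀ (mem_of_mem_nhds hV) t ht
    rw [← hP _ _ w]
    exact hu _ _ _ fun s => hVsub (hw s)
  refine ⟨fun he => ?_, fun S g hg hS => ?_⟩
  · rwa [he, sub_self, sub_eq_zero] at hinc
  · have hsb := h.seg_subset_ball (mem_ball_self hr) (hVsub ht)
    rw [hinc]
    exact h.potential_sub_eq hu hg (hsb.trans hball) hsb hS

/-- The radial retraction is homotopic to the identity in the complement of the center. -/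
lemma exists_trunc_homotopy (q : X) {δ : ℝ} (hδ : 0 < δ) :
    ∃ H : unitInterval × X → X, Continuous H ∧ (∀ x, H (0, x) = x) ∧
      (∀ x, H (1, x) = h.trunc q δ hδ x) ∧ ∀ s, ∀ x ≠ q, H (s, x) ≠ q := by
  have hle : ∀ x, δ / max δ (dist q x) ≤ 1 := fun x =>
    div_le_one_of_le₀ (le_max_left _ _) (by positivity)
  have hpos : ∀ x, 0 < δ / max δ (dist q x) := fun x => by positivity
  have hτ : ∀ z : unitInterval × X, 0 < 1 - (z.1 : ℝ) * (1 - δ / max δ (dist q z.2)) := fun z => by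
    nlinarith [z.1.2.1, z.1.2.2, hle z.2, hpos z.2]
  refine ⟨fun z => h.geo q z.2 ⟨1 - (z.1 : ℝ) * (1 - δ / max δ (dist q z.2)), (hτ z).le, ?_⟩,
    ?_, fun x => ?_, fun x => ?_, fun s x hx => ?_⟩
  · nlinarith [z.1.2.1, hle z.2]
  · refine (h.continuous_geo q).comp (continuous_snd.prodMk (Continuous.subtype_mk ?_ _))
    have : Continuous fun z : unitInterval × X => δ / max δ (dist q z.2) :=
      continuous_const.div (by fun_prop) fun x => (lt_max_of_lt_left hδ).ne'
    fun_prop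
  · simpa using h.geo_one q x
  · simp [trunc]
  · rw [← dist_pos, dist_comm, h.dist_geo_left]
    exact mul_pos (hτ (s, x)) (dist_pos.2 hx.symm)

end IsCATZero

end

section

variable {X : Type*} [MetricSpace X] {A : Type*} [AddCommGroup A] {κ : ℝ}

/-! ### Local non-extendability forces a curve to be nullhomologous -/

namespace PolyComplex2

variable (PC : PolyComplex2 κ X)
include PC

lemma disjoint_faces {G G' : Set X} (hG : G ∈ PC.faces) (hG' : G' ∈ PC.faces) (hne : G ≠ G') :
    Disjoint G G' :=
  disjoint_iff_inter_eq_empty.2 (PC.cells_disjoint G (Or.inl hG) G' (Or.inl hG') hne)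

lemma notMem_face_of_mem_closure {G G' : Set X} (hG : G ∈ PC.faces) (hG' : G' ∈ PC.faces) {x : X}
    (hx : x ∈ closure G) (hxG : x ∉ G) : x ∉ G' := by
  rcases eq_or_ne G' G with rfl | hne
  · exact hxG
  · exact ((PC.disjoint_faces hG' hG hne).closure_right
      (PC.faces_open G' hG')).notMem_of_mem_right hx

end PolyComplex2

lemma exists_winding_lift {h : IsCATZero X} {G : Set X} {q y : X} {δ : ℝ} {hδ : 0 < δ}
    {F : X → AddCircle (1 : ℝ)} {g : X → ℝ} (hs : IsSector h G q δ hδ y F g) {γ : SCC X}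
    (hy : y ∉ γ.img) :
    ∃ θ : unitInterval → ℝ, Continuous θ ∧
      (∀ t : unitInterval, (θ t : AddCircle (1 : ℝ)) = F (γ.toFun t)) ∧
      (γ.NullhomologousIn {y}ᶜ → θ 1 = θ 0) := by
  have hsub : γ.img ⊆ {y}ᶜ := fun z hz hzy => hy (by rwa [← mem_singleton_iff.1 hzy])
  let f : C(({y}ᶜ : Set X), AddCircle (1 : ℝ)) := ⟨_, hs.continuousOn_F.domRestrict⟩
  obtain ⟨θ, hθ, hθf⟩ := exists_circleLift (f.comp (γ.pathIn _ hsub).toContinuousMap)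
  refine ⟨θ, hθ, hθf, fun hnull => ?_⟩
  have h1 := (winding f).eq_zero_of_loopClassH1 (hnull hsub)
  rw [winding_eq f _ hθ hθf] at h1
  exact sub_eq_zero.1 h1

lemma exists_eq_add_floor_smul {Y : Type*} {T : Set Y} {g : Y → ℝ} (hg : ∀ x ∈ T, g x = 0 ∨ g x = 1)
    (hinj : InjOn g T) (w : Y → A) : ∃ α a : A, ∀ x ∈ T, w x = α + ⌊g x⌋ • a := by
  classical
  have key : ∀ r : ℝ, ∃ b, ∀ x ∈ T, g x = r → w x = b := by
    intro r
    by_cases hr : ∃ x ∈ T, g x = r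
    · obtain ⟨x, hx, hxr⟩ := hr
      exact ⟨w x, fun z hz hzr => by rw [hinj hz hx (hzr.trans hxr.symm)]⟩
    · exact ⟨0, fun x hx hxr => (hr ⟨x, hx, hxr⟩).elim⟩
  obtain ⟨α, hα⟩ := key 0
  obtain ⟨β, hβ⟩ := key 1
  refine ⟨α, β - α, fun x hx => ?_⟩
  rcases hg x hx with h0 | h1
  · rw [hα x hx h0, h0]; simp
  · rw [hβ x hx h1, h1]; simp

namespace IsFaceChart

variable {G : Set X} {φ : X → ℝ × ℝ} {ψ : ℝ × ℝ → X} (hc : IsFaceChart G φ ψ)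
include hc

lemma seg_subset_closure_diff {q c x : X} (hqG : q ∉ G) (hcG : c ∈ G) (hx : x ∈ closure G \ {q}) :
    seg c x ⊆ closure G \ {q} := by
  intro z hz
  refine ⟨hc.seg_subset c (subset_closure hcG) x hx.1 hz, fun hzq => ?_⟩
  rcases eq_or_ne z x with rfl | hne
  · exact hx.2 hzq
  · exact hqG (mem_singleton_iff.1 hzq ▸ hc.mem_face_of_mem_seg hcG hx.1 hz hne)

/-- A potential on a punctured closed face, normalized along the boundary. -/
lemma exists_isPotential (h : IsCATZero X) {γ : SCC X} {p q y : X} {δ ε : ℝ} {hδ : 0 < δ}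
    {F : X → AddCircle (1 : ℝ)} {g : X → ℝ} (hs : IsSector h G q δ hδ y F g) (hδε : δ < ε)
    (hqG : q ∉ G) (hG : (G ∩ ball q ε).Nonempty) (hγ : Disjoint (ball q ε) γ.img)
    (hext : closure G ∩ ball q ε ⊆ γ.interiorSet → ∀ x ∈ closure G ∩ ball q ε, x ≠ q → q ∉ seg p x)
    (hbd : ∀ x ∈ closure G, x ∉ G → dist q x = δ → ∀ z ∈ seg q x, z ∉ G)
    {Φ : PathCocycle ({q}ᶜ : Set X) A} {u : X → A} (hu : IsPotential Φ {x | q ∉ seg p x} u) :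
    ∃ (pot : X → A) (a : A), IsPotential Φ (closure G \ {q}) pot ∧
      (∀ x ∈ closure G, x ∉ G → dist q x = δ → u x = pot x - ⌊g x⌋ • a) ∧
      (a = 0 ∨ γ.NullhomologousIn {y}ᶜ) := by
  obtain ⟨c, hcG, hcε⟩ := hG
  have hcq : c ≠ q := fun h => hqG (h ▸ hcG)
  obtain ⟨pot, hpot⟩ := Cat2Cx.exists_isPotential Φ
    (S := closure G \ {q}) (fun x hx => hx.2) (h.contractibleSpace_of_seg_subset
      ⟨subset_closure hcG, hcq⟩ fun x hx => hc.seg_subset_closure_diff hqG hcG hx)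
  rcases hc.subset_interiorSet_or h hγ with hin | hnull
  · refine ⟨fun x => pot x - (pot c - u c), 0, hpot.sub_const _, fun x hx _ hxd => ?_, Or.inl rfl⟩
    have hxq : x ≠ q := by rintro rfl; rw [dist_self] at hxd; exact hδ.ne hxd
    have hxε : x ∈ ball q ε := by rw [mem_ball', hxd]; exact hδε
    have hseg := hc.seg_subset_closure_diff hqG hcG ⟨hx, hxq⟩
    have := h.potential_sub_eq hpot hu (fun z hz => (hseg hz).2) hseg fun z hz =>
      hext hin z ⟨(hseg hz).1, h.seg_subset_ball hcε hxε hz⟩ (hseg hz).2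
    rw [smul_zero, sub_zero]
    beta_reduce
    rw [← sub_add, this, sub_add_cancel]
  · obtain ⟨α, a, hα⟩ := exists_eq_add_floor_smul
      (T := {x | x ∈ closure G ∧ x ∉ G ∧ dist q x = δ}) (g := g)
      (fun x hx => hs.g_boundary x hx.1 hx.2.2 hx.2.1)
      (fun x hx x' hx' hxx' => hs.eq_of_boundary x hx.1 x' hx'.1 hx.2.2 hx'.2.2
        (hbd x hx.1 hx.2.1 hx.2.2) (hbd x' hx'.1 hx'.2.1 hx'.2.2) hxx') (fun x => pot x - u x)
    refine ⟨fun x => pot x - α, a, hpot.sub_const _, fun x hx hxG hxd => ?_, Or.inr ?_⟩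
    · have := hα x ⟨hx, hxG, hxd⟩
      rw [sub_sub, ← this]
      abel
    · exact hnull y ⟨hs.mem, by rw [mem_ball']; exact hs.dist_lt.trans hδε⟩

end IsFaceChart

theorem PolyComplex2.nullhomologousIn_compl_singleton (hκ : κ ≤ 0) (PC : PolyComplex2 κ X)
    (h : IsCATZero X) {γ : SCC X} {p q : X} (hpq : p ≠ q) {ε : ℝ} (hε : 0 < ε)
    (hqG : ∀ G ∈ PC.faces, q ∉ G) (hγ : Disjoint (ball q ε) γ.img)
    (hfin : {c | (c ∈ PC.faces ∨ c ∈ PC.edges) ∧ (c ∩ ball q ε).Nonempty}.Finite)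
    (hcl : ∀ c, (c ∈ PC.faces ∨ c ∈ PC.edges) → (c ∩ ball q ε).Nonempty → q ∈ closure c)
    (hv : PC.vertices ∩ ball q ε ⊆ {q})
    (hext : ∀ G ∈ PC.faces, (G ∩ ball q ε).Nonempty → closure G ∩ ball q ε ⊆ γ.interiorSet →
      ∀ x ∈ closure G ∩ ball q ε, x ≠ q → q ∉ seg p x) :
    γ.NullhomologousIn {q}ᶜ := by
  classical
  have : Nonempty X := ⟨q⟩
  intro hsub
  obtain ⟨𝓕, h𝓕⟩ : ∃ 𝓕 : Finset (Set X), ∀ G, G ∈ 𝓕 ↔ G ∈ PC.faces ∧ (G ∩ ball q ε).Nonempty :=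
    ⟨(hfin.subset (t := {G | G ∈ PC.faces ∧ (G ∩ ball q ε).Nonempty}) fun G hG =>
      ⟨Or.inl hG.1, hG.2⟩).toFinset, fun G => by simp⟩
  have hchart : ∀ G ∈ 𝓕, ∃ φ ψ, IsFaceChart G φ ψ := fun G hG =>
    PC.exists_isFaceChart hκ h ((h𝓕 G).1 hG).1
  obtain ⟨δ, hδ, hδε, hsec⟩ : ∃ (δ : ℝ) (hδ : 0 < δ), δ < ε ∧ ∀ G ∈ 𝓕, ∃ y F g,
      IsSector h G q δ hδ y F g := by
    have h1 : ∀ G ∈ 𝓕, ∀ᶠ δ in 𝓝[>] (0 : ℝ), ∀ hδ : 0 < δ, ∃ y F g,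
        IsSector h G q δ hδ y F g := by
      intro G hG
      obtain ⟨φ, ψ, hc⟩ := hchart G hG
      obtain ⟨hGf, c, hcG, -⟩ := (h𝓕 G).1 hG
      obtain ⟨δ₀, hδ₀, hδ₀'⟩ := hc.exists_isSector h
        (hcl G (Or.inl hGf) ((h𝓕 G).1 hG).2) (hqG G hGf) hcG
      filter_upwards [Ioo_mem_nhdsGT hδ₀] with δ hδ hδ'
      exact hδ₀' δ hδ' hδ.2
    obtain ⟨δ, hδ1, hδ2⟩ :=
      (((eventually_all_finset 𝓕).2 h1).and (Ioo_mem_nhdsGT hε)).exists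
    exact ⟨δ, hδ2.1, hδ2.2, fun G hG => hδ1 G hG hδ2.1⟩
  have hsec' : ∀ G, ∃ y F g, G ∈ 𝓕 → IsSector h G q δ hδ y F g := by
    intro G
    by_cases hG : G ∈ 𝓕
    · obtain ⟨y, F, g, hs⟩ := hsec G hG
      exact ⟨y, F, g, fun _ => hs⟩
    · exact ⟨q, 0, 0, fun h => (hG h).elim⟩
  choose y F g hsec using hsec'
  have hedge : ∀ x, dist q x = δ → (∀ G ∈ PC.faces, x ∉ G) →
      ∃ e ∈ PC.edges, e ∉ PC.faces ∧ x ∈ e ∧ q ∈ closure e ∧ (e ∩ ball q ε).Nonempty := by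
    intro x hxd hxG
    have hxε : x ∈ ball q ε := by rw [mem_ball', hxd]; exact hδε
    have hxq : x ≠ q := by rintro rfl; rw [dist_self] at hxd; exact hδ.ne hxd
    obtain ⟨e, he, heF, hxe, hqe⟩ := PC.exists_edge_of_notMem_face hcl hv hxε hxq hxG
    exact ⟨e, he, heF, hxe, hqe, x, hxe, hxε⟩
  have hbd : ∀ G ∈ 𝓕, ∀ x ∈ closure G, x ∉ G → dist q x = δ → ∀ z ∈ seg q x, z ∉ G := by
    intro G hG x hx hxG hxd z hz
    have hGf := ((h𝓕 G).1 hG).1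
    obtain ⟨e, he, heF, hxe, hqe, -⟩ := hedge x hxd
      fun G' hG' => PC.notMem_face_of_mem_closure hGf hG' hx hxG
    exact PC.notMem_face_of_mem_closure_edge he hGf heF
      (PC.seg_subset_closure_edge h he hqe (subset_closure hxe) hz)
  have hE : {x | dist q x = δ ∧ ∀ G ∈ 𝓕, x ∉ G}.Finite := by
    refine (Set.Finite.biUnion (hfin.subset (inter_subset_left (t := {e | e ∈ PC.edges ∧
      q ∈ closure e}))) fun e he => PC.finite_closure_edge_inter_sphere he.2.1 he.2.2 δ).subset ?_
    rintro x ⟨hxd, hx⟩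
    obtain ⟨e, he, -, hxe, hqe, hne⟩ := hedge x hxd fun G hG hxG =>
      hx G ((h𝓕 G).2 ⟨hG, x, hxG, by rw [mem_ball', hxd]; exact hδε⟩) hxG
    exact mem_biUnion ⟨⟨Or.inr he, hne⟩, he, hqe⟩ ⟨subset_closure hxe, hxd⟩
  obtain ⟨Φ, hΦ⟩ := exists_pathCocycle (γ.basePoint _ hsub)
  suffices hzero : Φ.toFun (γ.pathIn _ hsub) = 0 by
    rw [hΦ] at hzero
    exact hzero
  obtain ⟨H, hHc, hH0, hH1, hHq⟩ := h.exists_trunc_homotopy q hδ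
  have hγq : ∀ t : unitInterval, γ.toFun t ≠ q := fun t => hsub ⟨t, t.2, rfl⟩
  have hγδ : ∀ t : unitInterval, δ ≤ dist q (γ.toFun t) := fun t => by
    by_contra hlt
    refine disjoint_left.1 hγ (mem_ball'.2 ?_) ⟨t, t.2, rfl⟩
    exact (not_le.1 hlt).trans hδε
  have hγc : Continuous fun t : unitInterval => γ.toFun t :=
    γ.contOn.comp_continuous continuous_subtype_val fun t => t.2
  let K : C(unitInterval × unitInterval, ({q}ᶜ : Set X)) :=
    ⟨fun z => ⟨H (z.1, γ.toFun z.2), hHq _ _ (hγq z.2)⟩, Continuous.subtype_mk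
      (hHc.comp (continuous_fst.prodMk (hγc.comp continuous_snd))) _⟩
  have hγloop : γ.toFun (0 : unitInterval) = γ.toFun (1 : unitInterval) := γ.loop
  have hK : ∀ s, K (s, 0) = K (s, 1) := fun s =>
    Subtype.ext (congrArg (fun x => H (s, x)) hγloop)
  let c : Path (K (1, 0)) (K (1, 0)) :=
    ⟨⟨fun t => K (1, t), by fun_prop⟩, rfl, (hK 1).symm⟩
  have hc : ∀ t, (c t : X) = h.trunc q δ hδ (γ.toFun t) := fun t => hH1 _
  have hcS : ∀ t, dist q (c t : X) = δ := fun t => by rw [hc, h.dist_trunc hδ (hγδ t)]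
  rw [Φ.eq_of_freeHomotopy K hK _ c (fun t => Subtype.ext (hH0 _).symm) fun t => rfl]
  obtain ⟨P, hP01, hP⟩ := h.exists_primitive Φ c
  obtain ⟨u, hu⟩ := Cat2Cx.exists_isPotential Φ (S := {x | q ∉ seg p x})
    (by rintro x hx rfl; exact hx (right_mem_seg p x))
    (h.contractibleSpace_of_seg_subset (z := p) (by simpa [seg_self] using hpq.symm)
      fun x hx z hz hqz => hx (seg_subset_seg_left hz hqz))
  have hpot : ∀ G, ∃ (pot : X → _) (a : _), G ∈ 𝓕 → IsPotential Φ (closure G \ {q}) pot ∧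
      (∀ x ∈ closure G, x ∉ G → dist q x = δ → u x = pot x - ⌊g G x⌋ • a) ∧
      (a = 0 ∨ γ.NullhomologousIn {y G}ᶜ) := by
    intro G
    by_cases hG : G ∈ 𝓕
    · obtain ⟨φ, ψ, hch⟩ := hchart G hG
      have hGf := (h𝓕 G).1 hG
      obtain ⟨pot, a, hpa⟩ := hch.exists_isPotential h (hsec G hG) hδε (hqG G hGf.1) hGf.2 hγ
        (hext G hGf.1 hGf.2) (hbd G hG) hu
      exact ⟨pot, a, fun _ => hpa⟩
    · exact ⟨0, 0, fun h => (hG h).elim⟩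
  choose pot a hpot using hpot
  have hθ : ∀ G, ∃ θ : unitInterval → ℝ, G ∈ 𝓕 → Continuous θ ∧
      (∀ t : unitInterval, (θ t : AddCircle (1 : ℝ)) = F G (γ.toFun t)) ∧
      (γ.NullhomologousIn {y G}ᶜ → θ 1 = θ 0) := by
    intro G
    by_cases hG : G ∈ 𝓕
    · obtain ⟨θ, hθ⟩ := exists_winding_lift (hsec G hG) (γ := γ) (disjoint_left.1 hγ
        (mem_ball'.2 ((hsec G hG).dist_lt.trans hδε)))
      exact ⟨θ, fun _ => hθ⟩
    · exact ⟨0, fun h => (hG h).elim⟩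
  choose θ hθ using hθ
  rw [hP01, sub_eq_sum_floor_smul (c := fun t => (c t : X)) (pot := pot) (u := u) (a := a)
    (by fun_prop) hcS (by simp) (fun G hG => PC.faces_open G ((h𝓕 G).1 hG).1)
    (fun G hG G' hG' => PC.disjoint_faces ((h𝓕 G).1 hG).1 ((h𝓕 G').1 hG').1) hE hsec
    (fun G hG => (hθ G hG).1) (fun G hG t => ?_) (fun t₀ => ?_) fun G hG => (hpot G hG).2.1]
  · refine Finset.sum_eq_zero fun G hG => ?_
    rcases (hpot G hG).2.2 with h0 | hnull
    · rw [h0, smul_zero]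
    · rw [(hθ G hG).2.2 hnull, sub_self, zero_smul]
  · rw [(hθ G hG).2.1, hc, (hsec G hG).F_trunc]
  · filter_upwards [hP t₀, (continuous_subtype_val.comp c.continuous).continuousAt.eventually
      (ball_mem_nhds (c t₀ : X) hδ)] with t ht htb
    refine ⟨fun he => ht.1 (Subtype.ext he), fun G hG h1 h0 => ht.2 _ _ (hpot G hG).1 ?_⟩
    obtain ⟨φ, ψ, hch⟩ := hchart G hG
    refine fun z hz => ⟨hch.seg_subset _ h0 _ h1 hz, fun hzq => ?_⟩
    have hzb := h.seg_subset_ball (mem_ball_self hδ) htb hz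
    rw [mem_singleton_iff.1 hzq, mem_ball, hcS] at hzb
    exact lt_irrefl _ hzb

end

section

variable {X : Type*} [MetricSpace X] {κ : ℝ}

/-! ### Extending geodesics -/

lemma mem_seg_of_mem_seg_right {p q x z : X} (hq : q ∈ seg p x) (hz : z ∈ seg q x) :
    q ∈ seg p z := by
  simp only [seg, mem_ofPred_eq] at *
  linarith [dist_triangle p q z, dist_triangle p z x]

/-- A geodesic ending at an interior point of a curve `γ` meets `γ` in some extension. -/
lemma IsCATZero.exists_mem_img_of_mem_interiorSet (h : IsCATZero X) {γ : SCC X} {p q : X}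
    (hpq : p ≠ q) (hq : q ∈ γ.interiorSet) : ∃ x ∈ γ.img, q ∈ seg p x := by
  by_contra! hno
  have hV : ContractibleSpace {x | q ∉ seg p x} :=
    h.contractibleSpace_of_seg_subset (z := p) (by simpa [seg_self] using hpq.symm)
      fun x hx z hz hqz => hx (seg_subset_seg_left hz hqz)
  refine hq.2 ((SCC.nullhomologousIn_of_contractibleSpace hV).mono hno ?_)
  rintro x hx rfl
  exact hx (right_mem_seg p x)

theorem PolyComplex2.exists_geodesic_extension (hκ : κ ≤ 0) (PC : PolyComplex2 κ X)
    (h : IsCATZero X) {γ : SCC X} {p q : X} (hpq : p ≠ q) (hq : q ∈ γ.interiorSet) :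
    ∃ y, y ≠ q ∧ q ∈ seg p y ∧ seg q y ⊆ γ.interiorSet := by
  have : Nonempty X := ⟨q⟩
  obtain ⟨ε, hε, hγ, hfin, hcl, hv⟩ := PC.exists_conical_ball γ.isCompact_img.isClosed hq.1
  by_cases hG : ∃ G ∈ PC.faces, q ∈ G
  · obtain ⟨G, hG, hqG⟩ := hG
    obtain ⟨φ, ψ, hc⟩ := PC.exists_isFaceChart hκ h hG
    have hin : closure G ∩ ball q ε ⊆ γ.interiorSet := (hc.subset_interiorSet_or h hγ).resolve_right
      fun hnull => hq.2 (hnull q ⟨hqG, mem_ball_self hε⟩)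
    obtain ⟨x, hx, hqx⟩ := h.exists_mem_img_of_mem_interiorSet hpq hq
    have hxq : 0 < dist q x := dist_pos.2 fun hxq => hq.1 (hxq ▸ hx)
    obtain ⟨r, hr, hrG⟩ := Metric.isOpen_iff.1 hc.isOpen q hqG
    have hm : 0 < min (min r ε / 2) (dist q x) := by positivity
    obtain ⟨z, hz, hzd⟩ := h.exists_mem_seg_dist_eq q x hm.le (min_le_right _ _)
    have hzr : dist q z < min r ε := by
      have := min_le_left (min r ε / 2) (dist q x)
      have : 0 < min r ε := lt_min hr hε
      linarith
    refine ⟨z, ?_, mem_seg_of_mem_seg_right hqx hz, fun w hw => hin ⟨?_, ?_⟩⟩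
    · rintro rfl
      rw [dist_self] at hzd
      exact hm.ne hzd
    · exact hc.seg_subset q (subset_closure hqG) z
        (subset_closure (hrG (mem_ball'.2 (hzr.trans_le (min_le_left _ _))))) hw
    · exact h.seg_subset_ball (mem_ball_self hε) (mem_ball'.2 (hzr.trans_le (min_le_right _ _))) hw
  · push Not at hG
    by_contra! hno
    refine hq.2 (PC.nullhomologousIn_compl_singleton hκ h hpq hε hG hγ hfin hcl hv ?_)
    intro G hGf hGε hin x hx hxq hqx
    obtain ⟨φ, ψ, hc⟩ := PC.exists_isFaceChart hκ h hGf
    exact hno x hxq hqx fun z hz => hin ⟨hc.seg_subset q (hcl G (Or.inl hGf) hGε) x hx.1 hz,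
      h.seg_subset_ball (mem_ball_self hε) hx.2 hz⟩

end

end Cat2Cx

end

open Cat2Cx in
/-- **Lemma (geodesic_extension_lemma).**  Let `γ` be a simple closed curve in `X`.  Then
`Int γ` locally extends geodesics: every `X`-geodesic `[p,q]_X ⊆ Int γ` extends to an
`X`-geodesic `[p,q']_X ⊆ Int γ` with `[p,q]_X` properly contained in `[p,q']_X`. -/
theorem interiorSet_locally_extends_geodesics
    {κ : ℝ} (hκ : κ ≤ 0) {X : Type*} [MetricSpace X]
    (PC : PolyComplex2 κ X) (hX : IsCATSpace κ X)
    (γ : SCC X) (p q : X) (hpq : p ≠ q)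
    (hsub : geodSeg (xDist X) Set.univ p q ⊆ γ.interiorSet) :
    ∃ q' : X,
      geodSeg (xDist X) Set.univ p q' ⊆ γ.interiorSet ∧
      geodSeg (xDist X) Set.univ p q ⊆ geodSeg (xDist X) Set.univ p q' ∧
      geodSeg (xDist X) Set.univ p q ≠ geodSeg (xDist X) Set.univ p q' := by
  have h := hX.isCATZero hκ
  simp only [h.geodSeg_eq_seg] at hsub ⊢
  obtain ⟨y, hyq, hqy, hy⟩ := PC.exists_geodesic_extension hκ h hpq (hsub (right_mem_seg p q))
  refine ⟨y, fun z hz => (h.seg_subset_union hqy hz).elim (fun hz => hsub hz) fun hz => hy hz,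
    seg_subset_seg_left hqy, fun he => hyq ?_⟩
  have hyp : y ∈ seg p q := he ▸ right_mem_seg p y
  have hle := dist_le_of_mem_seg hyp
  simp only [seg, Set.mem_ofPred_eq] at hqy
  exact (dist_le_zero.1 (by linarith : dist q y ≤ 0)).symm
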